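/- Let {f_ε}_{0≤ε≤ε₀} be a good family and let s₀ be the scaling function of f₀ (the pointwise limit of the scaling functions s_ε as ε decreases to 0). Then s₀ is continuous at every point of B, and the restriction of s₀ to B is Hölder continuous: there are constants C > 0 and 0 < λ < 1 such that |s₀(a*) − s₀(b*)| ≤ Cλⁿ for all a*, b* ∈ B agreeing in their first n coordinates. -/

import Mathlib

open Set MeasureTheory Filter Topology

noncomputable def len (s : Set ℝ) : ℝ := (volume s).toReal

noncomputable def branch (f : ℝ → ℝ) : Bool → ℝ → ℝ
  | false => Function.invFunOn f (Icc (-1) 0)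
  | true => Function.invFunOn f (Icc 0 1)

noncomputable def gw (f : ℝ → ℝ) : List Bool → ℝ → ℝ
  | [] => id
  | b :: w => branch f b ∘ gw f w

noncomputable def Iw (f : ℝ → ℝ) (w : List Bool) : Set ℝ := gw f w '' Icc (-1) 1

def word (a : ℕ → Bool) (n : ℕ) : List Bool := ((List.range (n + 1)).reverse).map a

noncomputable def ratio (f : ℝ → ℝ) (a : ℕ → Bool) (n : ℕ) : ℝ :=
  len (Iw f (word a n)) / len (Iw f ((word a n).dropLast))

def IsScalingFun (f : ℝ → ℝ) (s : (ℕ → Bool) → ℝ) : Prop :=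
  ∀ a : ℕ → Bool, Tendsto (ratio f a) atTop (nhds (s a))

def HolderOnDual (s : (ℕ → Bool) → ℝ) : Prop :=
  ∃ C > (0:ℝ), ∃ lam ∈ Ioo (0:ℝ) 1, ∀ a b : ℕ → Bool, ∀ n : ℕ,
    (∀ k < n, a k = b k) → |s a - s b| ≤ C * lam ^ n

def EvZero (a : ℕ → Bool) : Prop := ∃ N, ∀ n ≥ N, a n = false

def Lambda (f : ℝ → ℝ) : Set ℝ := {x | ∀ n : ℕ, f^[n] x ∈ Icc (-1) 1}

structure GoodFamily where
  eps0 : ℝ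
  eps0_pos : 0 < eps0
  f : ℝ → ℝ → ℝ
  f' : ℝ → ℝ → ℝ
  gamma : ℝ
  one_lt_gamma : 1 < gamma
  mono : ∀ ε ∈ Icc 0 eps0, StrictMonoOn (f ε) (Icc (-1) 0)
  anti : ∀ ε ∈ Icc 0 eps0, StrictAntiOn (f ε) (Icc 0 1)
  map_neg_one : ∀ ε ∈ Icc 0 eps0, f ε (-1) = -1
  map_one : ∀ ε ∈ Icc 0 eps0, f ε 1 = -1
  map_zero : ∀ ε ∈ Icc 0 eps0, f ε 0 = 1 + ε
  smooth : ContDiffOn ℝ 1 (fun p : ℝ × ℝ => f p.1 p.2) (Icc 0 eps0 ×ˢ Icc (-1) 1)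
  deriv_f : ∀ ε ∈ Icc 0 eps0, ∀ x ∈ Icc (-1:ℝ) 1,
    HasDerivWithinAt (f ε) (f' ε x) (Icc (-1) 1) x
  Rneg : ℝ → ℝ → ℝ
  Rpos : ℝ → ℝ → ℝ
  Rneg_cont : ContinuousOn (fun p : ℝ × ℝ => Rneg p.1 p.2) (Icc 0 eps0 ×ˢ Icc (-1) 0)
  Rpos_cont : ContinuousOn (fun p : ℝ × ℝ => Rpos p.1 p.2) (Icc 0 eps0 ×ˢ Icc 0 1)
  Rneg_ne : ∀ ε ∈ Icc 0 eps0, ∀ x ∈ Icc (-1:ℝ) 0, Rneg ε x ≠ 0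
  Rpos_ne : ∀ ε ∈ Icc 0 eps0, ∀ x ∈ Icc (0:ℝ) 1, Rpos ε x ≠ 0
  Rneg_eq : ∀ ε ∈ Icc 0 eps0, ∀ x ∈ Ico (-1:ℝ) 0, Rneg ε x = f' ε x / |x| ^ (gamma - 1)
  Rpos_eq : ∀ ε ∈ Icc 0 eps0, ∀ x ∈ Ioc (0:ℝ) 1, Rpos ε x = f' ε x / |x| ^ (gamma - 1)
  K' : ℝ
  K'_pos : 0 < K'
  alpha' : ℝ
  alpha'_mem : alpha' ∈ Ioc (0:ℝ) 1
  holder' : ∀ ε ∈ Icc 0 eps0, ∀ x ∈ Icc (-1:ℝ) 1, ∀ y ∈ Icc (-1:ℝ) 1,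
    |f' ε x - f' ε y| ≤ K' * |x - y| ^ alpha'
  K'' : ℝ
  K''_pos : 0 < K''
  alpha'' : ℝ
  alpha''_mem : alpha'' ∈ Ioc (0:ℝ) 1
  holder''_neg : ∀ ε ∈ Icc 0 eps0, ∀ x ∈ Ico (-1:ℝ) 0, ∀ y ∈ Ico (-1:ℝ) 0,
    |f' ε x / |x| ^ (gamma - 1) - f' ε y / |y| ^ (gamma - 1)| ≤ K'' * |x - y| ^ alpha''
  holder''_pos : ∀ ε ∈ Icc 0 eps0, ∀ x ∈ Ioc (0:ℝ) 1, ∀ y ∈ Ioc (0:ℝ) 1,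
    |f' ε x / |x| ^ (gamma - 1) - f' ε y / |y| ^ (gamma - 1)| ≤ K'' * |x - y| ^ alpha''
  C0 : ℝ
  C0_pos : 0 < C0
  lam : ℝ
  lam_mem : lam ∈ Ioo (0:ℝ) 1
  decay : ∀ ε ∈ Icc 0 eps0, ∀ n : ℕ, 1 ≤ n → ∀ w : List Bool, w.length = n + 1 →
    len (Iw (f ε) w) ≤ C0 * lam ^ n

/-- The logarithms of the lengths of the images of pairs of points of `[-1, 1]` under `h₁` and
`h₂` differ by a constant, up to an error `η`. -/
def LogCmp (η : ℝ) (h₁ h₂ : ℝ → ℝ) : Prop :=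
  ∀ x ∈ Icc (-1 : ℝ) 1, ∀ y ∈ Icc (-1 : ℝ) 1, ∀ x' ∈ Icc (-1 : ℝ) 1, ∀ y' ∈ Icc (-1 : ℝ) 1,
    x ≠ y → x' ≠ y' →
    |(Real.log |h₁ x - h₁ y| - Real.log |h₂ x - h₂ y|)
      - (Real.log |h₁ x' - h₁ y'| - Real.log |h₂ x' - h₂ y'|)| ≤ η

namespace LogCmp

variable {η η' : ℝ} {h₁ h₂ h₃ : ℝ → ℝ}

theorem refl (h : ℝ → ℝ) : LogCmp 0 h h := by
  intro x _ y _ x' _ y' _ _ _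
  simp

theorem symm (H : LogCmp η h₁ h₂) : LogCmp η h₂ h₁ := by
  intro x hx y hy x' hx' y' hy' hxy hxy'
  have := H x hx y hy x' hx' y' hy' hxy hxy'
  rw [abs_le] at this ⊢
  constructor <;> linarith [this.1, this.2]

theorem trans (H : LogCmp η h₁ h₂) (H' : LogCmp η' h₂ h₃) : LogCmp (η + η') h₁ h₃ := by
  intro x hx y hy x' hx' y' hy' hxy hxy'
  have h1 := H x hx y hy x' hx' y' hy' hxy hxy'
  have h2 := H' x hx y hy x' hx' y' hy' hxy hxy'
  rw [abs_le] at h1 h2 ⊢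
  constructor <;> linarith [h1.1, h1.2, h2.1, h2.2]

theorem mono (H : LogCmp η h₁ h₂) (h : η ≤ η') : LogCmp η' h₁ h₂ :=
  fun x hx y hy x' hx' y' hy' hxy hxy' => (H x hx y hy x' hx' y' hy' hxy hxy').trans h

theorem comp (H : LogCmp η h₁ h₂) {k : ℝ → ℝ} (hk : MapsTo k (Icc (-1) 1) (Icc (-1) 1))
    (hi : InjOn k (Icc (-1) 1)) : LogCmp η (h₁ ∘ k) (h₂ ∘ k) :=
  fun _ hx _ hy _ hx' _ hy' hxy hxy' => H _ (hk hx) _ (hk hy) _ (hk hx') _ (hk hy')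
    (fun h => hxy (hi hx hy h)) (fun h => hxy' (hi hx' hy' h))

/-- Ratios of lengths of images, when at most `1`, are close for close maps. -/
theorem abs_ratio_sub_le (H : LogCmp η h₁ h₂) (i₁ : InjOn h₁ (Icc (-1) 1))
    (i₂ : InjOn h₂ (Icc (-1) 1)) {x y x' y' : ℝ} (hx : x ∈ Icc (-1 : ℝ) 1)
    (hy : y ∈ Icc (-1 : ℝ) 1) (hx' : x' ∈ Icc (-1 : ℝ) 1) (hy' : y' ∈ Icc (-1 : ℝ) 1)
    (hxy : x ≠ y) (hxy' : x' ≠ y') (l₁ : |h₁ x - h₁ y| ≤ |h₁ x' - h₁ y'|)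
    (l₂ : |h₂ x - h₂ y| ≤ |h₂ x' - h₂ y'|) :
    |(|h₁ x - h₁ y| / |h₁ x' - h₁ y'|) - (|h₂ x - h₂ y| / |h₂ x' - h₂ y'|)| ≤ η := by
  have p₁ : 0 < |h₁ x - h₁ y| := abs_pos.2 (sub_ne_zero.2 fun h => hxy (i₁ hx hy h))
  have p₂ : 0 < |h₂ x - h₂ y| := abs_pos.2 (sub_ne_zero.2 fun h => hxy (i₂ hx hy h))
  have q₁ : 0 < |h₁ x' - h₁ y'| := p₁.trans_le l₁
  have q₂ : 0 < |h₂ x' - h₂ y'| := p₂.trans_le l₂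
  have key := H x hx y hy x' hx' y' hy' hxy hxy'
  set r₁ := |h₁ x - h₁ y| / |h₁ x' - h₁ y'| with hr₁
  set r₂ := |h₂ x - h₂ y| / |h₂ x' - h₂ y'| with hr₂
  have r₁p : 0 < r₁ := div_pos p₁ q₁
  have r₂p : 0 < r₂ := div_pos p₂ q₂
  have r₁1 : r₁ ≤ 1 := (div_le_one q₁).2 l₁
  have r₂1 : r₂ ≤ 1 := (div_le_one q₂).2 l₂
  have e₁ : Real.log r₁ = Real.log |h₁ x - h₁ y| - Real.log |h₁ x' - h₁ y'| :=
    Real.log_div p₁.ne' q₁.ne'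
  have e₂ : Real.log r₂ = Real.log |h₂ x - h₂ y| - Real.log |h₂ x' - h₂ y'| :=
    Real.log_div p₂.ne' q₂.ne'
  have key' : |Real.log r₁ - Real.log r₂| ≤ η := by
    rw [e₁, e₂]
    convert key using 2
    ring
  have aux : ∀ a b : ℝ, 0 < a → 0 < b → a ≤ 1 → a - b ≤ |Real.log a - Real.log b| := by
    intro a b ha hb ha1
    have h1 := Real.log_le_sub_one_of_pos (div_pos hb ha)
    rw [Real.log_div hb.ne' ha.ne'] at h1
    rcases le_total a b with hab | hab
    · linarith [abs_nonneg (Real.log a - Real.log b)]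
    · have h2 : a - b ≤ (a - b) / a := by
        rw [le_div_iff₀ ha]
        nlinarith
      have h3 : (a - b) / a = 1 - b / a := by field_simp
      linarith [le_abs_self (Real.log a - Real.log b)]
  refine le_trans (abs_le.2 ⟨?_, ?_⟩) key'
  · have := aux r₂ r₁ r₂p r₁p r₂1
    rw [abs_sub_comm] at this
    linarith
  · exact aux r₁ r₂ r₁p r₂p r₁1

/-- A ratio of lengths of images is controlled by the ratio for a close map. -/
theorem le_of_le (H : LogCmp η h₁ h₂) (i₁ : InjOn h₁ (Icc (-1) 1))
    (i₂ : InjOn h₂ (Icc (-1) 1)) {x y x' y' κ : ℝ} (hx : x ∈ Icc (-1 : ℝ) 1)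
    (hy : y ∈ Icc (-1 : ℝ) 1) (hx' : x' ∈ Icc (-1 : ℝ) 1) (hy' : y' ∈ Icc (-1 : ℝ) 1)
    (hxy' : x' ≠ y') (hκ : |h₂ x - h₂ y| ≤ κ * |h₂ x' - h₂ y'|) :
    |h₁ x - h₁ y| ≤ Real.exp η * κ * |h₁ x' - h₁ y'| := by
  have q₁ : 0 < |h₁ x' - h₁ y'| := abs_pos.2 (sub_ne_zero.2 fun h => hxy' (i₁ hx' hy' h))
  have q₂ : 0 < |h₂ x' - h₂ y'| := abs_pos.2 (sub_ne_zero.2 fun h => hxy' (i₂ hx' hy' h))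
  rcases eq_or_ne x y with rfl | hxy
  · have : 0 ≤ κ := by
      by_contra! hneg
      simp only [sub_self, abs_zero] at hκ
      nlinarith
    simp only [sub_self, abs_zero]
    positivity
  have p₁ : 0 < |h₁ x - h₁ y| := abs_pos.2 (sub_ne_zero.2 fun h => hxy (i₁ hx hy h))
  have p₂ : 0 < |h₂ x - h₂ y| := abs_pos.2 (sub_ne_zero.2 fun h => hxy (i₂ hx hy h))
  have hκ0 : 0 < κ := by
    by_contra! hneg
    nlinarith
  have key := (abs_le.1 (H x hx y hy x' hx' y' hy' hxy hxy')).2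
  have h2 : Real.log |h₂ x - h₂ y| ≤ Real.log κ + Real.log |h₂ x' - h₂ y'| := by
    rw [← Real.log_mul hκ0.ne' q₂.ne']
    exact Real.log_le_log p₂ hκ
  rw [← Real.log_le_log_iff p₁ (by positivity), Real.log_mul (by positivity) q₁.ne',
    Real.log_mul (Real.exp_pos η).ne' hκ0.ne', Real.log_exp]
  linarith

/-- Increments of the power `s ∈ (0, 1]` of a nonnegative number, under multiplicative errors. -/
theorem rpow_sub_rpow_le {s c E A B A' B' : ℝ} (hs : s ∈ Ioc (0 : ℝ) 1) (hc : 0 < c)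
    (hE : 1 ≤ E) (hA' : 0 ≤ A') (hAB' : A' < B') (hAB : A < B)
    (h₁ : c / E * A' ≤ A) (h₂ : B - A ≤ c * E * (B' - A')) :
    B ^ s - A ^ s ≤ E ^ 2 * c ^ s * (B' ^ s - A' ^ s) := by
  have hE0 : 0 < E := by linarith
  have hcE : 0 < c / E := by positivity
  have hA : 0 ≤ A := le_trans (by positivity) h₁
  have conc := Real.concaveOn_rpow hs.1.le hs.2
  set a := c / E * A' with ha
  have ha0 : 0 ≤ a := by positivity
  have step₁ : B ^ s - A ^ s ≤ (a + (B - A)) ^ s - a ^ s := by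
    rcases eq_or_lt_of_le h₁ with h | h
    · rw [← h]; simp
    have hD : 0 < B - a := by linarith
    set t := (A - a) / (B - a) with ht
    have ht0 : 0 ≤ t := div_nonneg (by linarith) hD.le
    have ht1 : t ≤ 1 := (div_le_one hD).2 (by linarith)
    have hB : (0 : ℝ) ≤ B := by linarith
    have c₁ := conc.2 (mem_Ici.2 ha0) (mem_Ici.2 hB) (sub_nonneg.2 ht1) ht0 (by ring)
    have c₂ := conc.2 (mem_Ici.2 ha0) (mem_Ici.2 hB) ht0 (sub_nonneg.2 ht1) (by ring)
    have htD : t * (B - a) = A - a := by rw [ht]; field_simp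
    have e₁ : (1 - t) • a + t • B = A := by simp only [smul_eq_mul]; linarith
    have e₂ : t • a + (1 - t) • B = a + (B - A) := by simp only [smul_eq_mul]; linarith
    simp only [e₁, e₂] at c₁ c₂
    simp only [smul_eq_mul] at c₁ c₂
    linarith
  set d := c / E * (B' - A') with hd
  have hd0 : 0 < d := mul_pos hcE (by linarith)
  have step₂ : (a + (B - A)) ^ s - a ^ s ≤ (a + E ^ 2 * d) ^ s - a ^ s := by
    have : B - A ≤ E ^ 2 * d := by
      refine h₂.trans (le_of_eq ?_)
      rw [hd]; field_simp
    have := Real.rpow_le_rpow (by linarith) (add_le_add_right this a) hs.1.le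
    linarith
  have step₃ : (a + E ^ 2 * d) ^ s - a ^ s ≤ E ^ 2 * ((a + d) ^ s - a ^ s) := by
    have hE2 : 1 ≤ E ^ 2 := one_le_pow₀ hE
    set t := 1 / E ^ 2 with ht
    have ht0 : 0 ≤ t := by positivity
    have ht1 : t ≤ 1 := (div_le_one (by positivity)).2 hE2
    have c₁ := conc.2 (mem_Ici.2 ha0) (mem_Ici.2 (by positivity : 0 ≤ a + E ^ 2 * d))
      (sub_nonneg.2 ht1) ht0 (by ring)
    have e₁ : (1 - t) • a + t • (a + E ^ 2 * d) = a + d := by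
      simp only [smul_eq_mul, ht]; field_simp; ring
    simp only [e₁] at c₁
    simp only [smul_eq_mul] at c₁
    have : E ^ 2 * ((1 - t) * a ^ s + t * (a + E ^ 2 * d) ^ s)
        = E ^ 2 * a ^ s - a ^ s + (a + E ^ 2 * d) ^ s := by
      rw [ht]; field_simp
    nlinarith [mul_le_mul_of_nonneg_left c₁ (by positivity : (0:ℝ) ≤ E ^ 2)]
  have e₄ : (a + d) ^ s - a ^ s = (c / E) ^ s * (B' ^ s - A' ^ s) := by
    have : a + d = c / E * B' := by rw [ha, hd]; ring
    rw [this, ha, Real.mul_rpow hcE.le (by linarith), Real.mul_rpow hcE.le hA']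
    ring
  have h5 : (c / E) ^ s ≤ c ^ s :=
    Real.rpow_le_rpow hcE.le (div_le_self hc.le hE) hs.1.le
  have h6 : 0 ≤ B' ^ s - A' ^ s := by
    have := Real.rpow_le_rpow hA' hAB'.le hs.1.le
    linarith
  calc B ^ s - A ^ s ≤ E ^ 2 * ((a + d) ^ s - a ^ s) := by linarith
    _ = E ^ 2 * (c / E) ^ s * (B' ^ s - A' ^ s) := by rw [e₄]; ring
    _ ≤ _ := by gcongr

/-- Taking a power `s ∈ (0, 1]` preserves closeness of increasing maps vanishing at `-1`. -/
theorem rpow {s : ℝ} (hs : s ∈ Ioc (0 : ℝ) 1) (H : LogCmp η h₁ h₂) (hη : 0 ≤ η)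
    (m₁ : StrictMonoOn h₁ (Icc (-1) 1)) (m₂ : StrictMonoOn h₂ (Icc (-1) 1))
    (z₁ : h₁ (-1) = 0) (z₂ : h₂ (-1) = 0) :
    LogCmp (4 * η) (fun x => h₁ x ^ s) (fun x => h₂ x ^ s) := by
  have hm : (-1 : ℝ) ∈ Icc (-1 : ℝ) 1 := by simp
  have hp : (1 : ℝ) ∈ Icc (-1 : ℝ) 1 := by simp
  have nonneg : ∀ {h : ℝ → ℝ}, StrictMonoOn h (Icc (-1) 1) → h (-1) = 0 →
      ∀ x ∈ Icc (-1 : ℝ) 1, 0 ≤ h x := fun m z x hx => z ▸ m.monotoneOn hm hx hx.1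
  have upper : ∀ {k₁ k₂ : ℝ → ℝ}, LogCmp η k₁ k₂ → StrictMonoOn k₁ (Icc (-1) 1) →
      StrictMonoOn k₂ (Icc (-1) 1) → k₁ (-1) = 0 → k₂ (-1) = 0 →
      ∀ x ∈ Icc (-1 : ℝ) 1, ∀ y ∈ Icc (-1 : ℝ) 1, x < y →
      Real.log (k₁ y ^ s - k₁ x ^ s) - Real.log (k₂ y ^ s - k₂ x ^ s)
        ≤ 2 * η + s * (Real.log (k₁ 1) - Real.log (k₂ 1)) := by
    intro k₁ k₂ H m₁ m₂ z₁ z₂ x hx y hy hxy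
    have p₁ : 0 < k₁ 1 := z₁ ▸ m₁ hm hp (by norm_num)
    have p₂ : 0 < k₂ 1 := z₂ ▸ m₂ hm hp (by norm_num)
    have fwd : ∀ u ∈ Icc (-1 : ℝ) 1, ∀ v ∈ Icc (-1 : ℝ) 1, u < v →
        k₁ v - k₁ u ≤ k₁ 1 / k₂ 1 * Real.exp η * (k₂ v - k₂ u) ∧
        k₁ 1 / k₂ 1 / Real.exp η * (k₂ v - k₂ u) ≤ k₁ v - k₁ u := by
      intro u hu v hv huv
      have d₁ : 0 < k₁ v - k₁ u := sub_pos.2 (m₁ hu hv huv)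
      have d₂ : 0 < k₂ v - k₂ u := sub_pos.2 (m₂ hu hv huv)
      have key := H v hv u hu 1 hp (-1) hm huv.ne' (by norm_num)
      rw [z₁, z₂, sub_zero, sub_zero, abs_of_pos d₁, abs_of_pos d₂, abs_of_pos p₁,
        abs_of_pos p₂, abs_le] at key
      constructor
      · rw [← Real.log_le_log_iff d₁ (by positivity), Real.log_mul (by positivity) d₂.ne',
          Real.log_mul (by positivity) (Real.exp_pos η).ne', Real.log_exp,
          Real.log_div p₁.ne' p₂.ne']
        linarith [key.2]
      · rw [← Real.log_le_log_iff (by positivity) d₁, Real.log_mul (by positivity) d₂.ne',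
          Real.log_div (by positivity) (Real.exp_pos η).ne', Real.log_exp,
          Real.log_div p₁.ne' p₂.ne']
        linarith [key.1]
    have lowx : k₁ 1 / k₂ 1 / Real.exp η * k₂ x ≤ k₁ x := by
      rcases eq_or_lt_of_le hx.1 with h | h
      · rw [← h, z₁, z₂, mul_zero]
      · simpa [z₁, z₂] using (fwd (-1) hm x hx h).2
    have key := rpow_sub_rpow_le hs (div_pos p₁ p₂) (Real.one_le_exp hη) (nonneg m₂ z₂ x hx)
      (m₂ hx hy hxy) (m₁ hx hy hxy) lowx (fwd x hx y hy hxy).1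
    have d₁ : 0 < k₁ y ^ s - k₁ x ^ s :=
      sub_pos.2 (Real.rpow_lt_rpow (nonneg m₁ z₁ x hx) (m₁ hx hy hxy) hs.1)
    have d₂ : 0 < k₂ y ^ s - k₂ x ^ s :=
      sub_pos.2 (Real.rpow_lt_rpow (nonneg m₂ z₂ x hx) (m₂ hx hy hxy) hs.1)
    have q : 0 < k₁ 1 / k₂ 1 := div_pos p₁ p₂
    have := Real.log_le_log d₁ key
    rw [Real.log_mul (by positivity) d₂.ne', Real.log_mul (by positivity) (by positivity),
      Real.log_pow, Real.log_exp, Real.log_rpow q, Real.log_div p₁.ne' p₂.ne'] at this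
    push_cast at this
    linarith
  have both : ∀ x ∈ Icc (-1 : ℝ) 1, ∀ y ∈ Icc (-1 : ℝ) 1, x ≠ y →
      |Real.log |h₁ x ^ s - h₁ y ^ s| - Real.log |h₂ x ^ s - h₂ y ^ s|
        - s * (Real.log (h₁ 1) - Real.log (h₂ 1))| ≤ 2 * η := by
    have lt_case : ∀ x ∈ Icc (-1 : ℝ) 1, ∀ y ∈ Icc (-1 : ℝ) 1, x < y →
        |Real.log |h₁ y ^ s - h₁ x ^ s| - Real.log |h₂ y ^ s - h₂ x ^ s|
          - s * (Real.log (h₁ 1) - Real.log (h₂ 1))| ≤ 2 * η := by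
      intro x hx y hy hxy
      have u₁ := upper H m₁ m₂ z₁ z₂ x hx y hy hxy
      have u₂ := upper H.symm m₂ m₁ z₂ z₁ x hx y hy hxy
      rw [Real.log_abs, Real.log_abs, abs_le]
      constructor <;> linarith
    intro x hx y hy hxy
    rcases lt_or_gt_of_ne hxy with h | h
    · rw [abs_sub_comm (h₁ x ^ s), abs_sub_comm (h₂ x ^ s)]
      exact lt_case x hx y hy h
    · exact lt_case y hy x hx h
  intro x hx y hy x' hx' y' hy' hxy hxy'
  have b₁ := abs_le.1 (both x hx y hy hxy)
  have b₂ := abs_le.1 (both x' hx' y' hy' hxy')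
  rw [abs_le]
  constructor <;> linarith [b₁.1, b₁.2, b₂.1, b₂.2]

end LogCmp

/-- The constants controlling a family of unimodal maps uniformly. -/
structure UniformConstants where
  γ : ℝ
  α : ℝ
  K : ℝ
  c : ℝ
  M : ℝ
  C : ℝ
  lam : ℝ
  one_lt_γ : 1 < γ
  α_mem : α ∈ Ioc (0 : ℝ) 1
  K_pos : 0 < K
  c_pos : 0 < c
  M_pos : 0 < M
  C_pos : 0 < C
  lam_mem : lam ∈ Ioo (0 : ℝ) 1

namespace UniformConstants

variable (P : UniformConstants)

noncomputable def θ : ℝ := P.lam ^ P.α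

theorem θ_pos : 0 < P.θ := Real.rpow_pos_of_pos P.lam_mem.1 _

theorem θ_lt_one : P.θ < 1 := Real.rpow_lt_one P.lam_mem.1.le P.lam_mem.2 P.α_mem.1

theorem one_sub_θ_pos : 0 < 1 - P.θ := sub_pos.2 P.θ_lt_one

theorem θ_pow_le {m n : ℕ} (h : m ≤ n) : P.θ ^ n ≤ P.θ ^ m :=
  pow_le_pow_of_le_one P.θ_pos.le P.θ_lt_one.le h

theorem lam_le_θ : P.lam ≤ P.θ := by
  conv_lhs => rw [← Real.rpow_one P.lam]
  exact Real.rpow_le_rpow_of_exponent_ge P.lam_mem.1 P.lam_mem.2.le P.α_mem.2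

theorem lam_pow_le (n : ℕ) : P.lam ^ n ≤ P.θ ^ n :=
  pow_le_pow_left₀ P.lam_mem.1.le P.lam_le_θ n

theorem rpow_C_mul_lam_pow (n : ℕ) : (P.C * P.lam ^ n) ^ P.α = P.C ^ P.α * P.θ ^ n := by
  rw [Real.mul_rpow P.C_pos.le (pow_nonneg P.lam_mem.1.le n), θ, ← Real.rpow_natCast,
    ← Real.rpow_natCast, ← Real.rpow_mul P.lam_mem.1.le, ← Real.rpow_mul P.lam_mem.1.le,
    mul_comm P.α]

/-- Distortion constant for one step away from the critical point. -/
noncomputable def stepConst : ℝ := (P.γ - 1) * (P.M / P.c * P.C) + P.K * P.C ^ P.α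

/-- Distortion constant for the passage near the fixed endpoint. -/
noncomputable def fixConst : ℝ := P.stepConst / (1 - P.θ)

/-- Distortion constant for one step close to the critical point. -/
noncomputable def critConst : ℝ :=
  (P.γ - 1) * (P.M / P.c * (Real.exp P.fixConst * (P.M * P.C))) + P.K * P.C ^ P.α

/-- Distortion constant for the whole tail of a dual point. -/
noncomputable def tailConst : ℝ := (P.stepConst + P.critConst / P.θ) / (1 - P.θ)

/-- Distortion constant for the two steps leading from the fixed endpoint to the critical point. -/
noncomputable def powConst : ℝ := 4 * (2 * (P.K * P.C ^ P.α) + 2 * P.fixConst)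

theorem γ_sub_one_pos : 0 < P.γ - 1 := sub_pos.2 P.one_lt_γ

theorem stepConst_pos : 0 < P.stepConst := by
  have := P.γ_sub_one_pos
  have := P.K_pos
  have := P.c_pos
  have := P.M_pos
  have := P.C_pos
  unfold stepConst
  positivity

theorem fixConst_pos : 0 < P.fixConst := div_pos P.stepConst_pos P.one_sub_θ_pos

theorem critConst_pos : 0 < P.critConst := by
  have := P.γ_sub_one_pos
  have := P.K_pos
  have := P.c_pos
  have := P.M_pos
  have := P.C_pos
  unfold critConst
  positivity

theorem tailConst_pos : 0 < P.tailConst :=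
  div_pos (add_pos P.stepConst_pos (div_pos P.critConst_pos P.θ_pos)) P.one_sub_θ_pos

theorem powConst_pos : 0 < P.powConst := by
  have := P.K_pos
  have := P.C_pos
  have := P.fixConst_pos
  unfold powConst
  positivity

end UniformConstants

theorem gw_append (f : ℝ → ℝ) (u v : List Bool) : gw f (u ++ v) = gw f u ∘ gw f v := by
  induction u with
  | nil => rfl
  | cons b u ih => simp only [List.cons_append, gw, ih, Function.comp_assoc]

/-- The word `aₙ ⋯ a₁`. -/
def stem (a : ℕ → Bool) : ℕ → List Bool
  | 0 => []
  | n + 1 => a (n + 1) :: stem a n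

theorem stem_length (a : ℕ → Bool) (n : ℕ) : (stem a n).length = n := by
  induction n with
  | zero => rfl
  | succ n ih => simp [stem, ih]

theorem word_eq_stem (a : ℕ → Bool) (n : ℕ) : word a n = stem a n ++ [a 0] := by
  induction n with
  | zero => simp [word, stem]
  | succ n ih =>
    rw [word, List.range_succ, List.reverse_append, List.map_append]
    simp only [word] at ih
    rw [ih]
    simp [stem]

theorem stem_congr {a b : ℕ → Bool} {n : ℕ} (h : ∀ k ≤ n, a k = b k) : stem a n = stem b n := by
  induction n with
  | zero => rfl
  | succ n ih => rw [stem, stem, h _ le_rfl, ih fun k hk => h k (by omega)]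

theorem stem_add_eq {a : ℕ → Bool} {l m : ℕ} (h : ∀ j, l < j → j ≤ l + m → a j = false) :
    stem a (l + m) = List.replicate m false ++ stem a l := by
  induction m with
  | zero => rfl
  | succ m ih =>
    rw [← add_assoc, stem, h _ (by omega) (by omega), ih fun j h1 h2 => h j h1 (by omega),
      List.replicate_succ, List.cons_append]

/-- Uniform control of the two inverse branches of a unimodal map `f`. The function `ρ` is the
density of `f` with respect to the power `|x| ^ γ`, up to the factor `γ`. -/
structure ControlledBranches (P : UniformConstants) (f : ℝ → ℝ) (ρ : Bool → ℝ → ℝ) : Prop where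
  false_mem : ∀ y ∈ Icc (-1 : ℝ) 1, branch f false y ∈ Icc (-1 : ℝ) 0
  true_mem : ∀ y ∈ Icc (-1 : ℝ) 1, branch f true y ∈ Icc (0 : ℝ) 1
  anti : ∀ i, StrictAntiOn (fun y => |branch f i y|) (Icc (-1) 1)
  abs_neg_one : ∀ i, |branch f i (-1)| = 1
  image_uIcc : ∀ i, ∀ p ∈ Icc (-1 : ℝ) 1, ∀ q ∈ Icc (-1 : ℝ) 1,
    branch f i '' uIcc p q = uIcc (branch f i p) (branch f i q)
  exists_slope : ∀ i, ∀ y₁ ∈ Icc (-1 : ℝ) 1, ∀ y₂ ∈ Icc (-1 : ℝ) 1, y₁ < y₂ →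
    ∃ ξ ∈ Ioo |branch f i y₂| |branch f i y₁|,
      y₂ - y₁ = ξ ^ (P.γ - 1) * ρ i ξ * (|branch f i y₁| - |branch f i y₂|)
  exists_pow_slope : ∀ i, ∀ y₁ ∈ Icc (-1 : ℝ) 1, ∀ y₂ ∈ Icc (-1 : ℝ) 1, y₁ < y₂ →
    ∃ ξ ∈ Ioo |branch f i y₂| |branch f i y₁|,
      y₂ - y₁ = ρ i ξ / P.γ * (|branch f i y₁| ^ P.γ - |branch f i y₂| ^ P.γ)
  ρ_mem : ∀ i, ∀ ξ ∈ Ioo (0 : ℝ) 1, ρ i ξ ∈ Icc P.c P.M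
  log_ρ : ∀ i, ∀ ξ ∈ Ioo (0 : ℝ) 1, ∀ ξ' ∈ Ioo (0 : ℝ) 1,
    |Real.log (ρ i ξ) - Real.log (ρ i ξ')| ≤ P.K * |ξ - ξ'| ^ P.α
  one_sub_le : ∀ i, ∀ y ∈ Icc (-1 : ℝ) 1, 1 - y ≤ P.M * |branch f i y| ^ P.γ
  len_le : ∀ w, len (Iw f w) ≤ P.C * P.lam ^ w.length

namespace ControlledBranches

variable {P : UniformConstants} {f : ℝ → ℝ} {ρ : Bool → ℝ → ℝ}

theorem abs_sub (S : ControlledBranches P f ρ) (i : Bool) {y₁ y₂ : ℝ}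
    (h₁ : y₁ ∈ Icc (-1 : ℝ) 1) (h₂ : y₂ ∈ Icc (-1 : ℝ) 1) :
    |branch f i y₁ - branch f i y₂| = |(|branch f i y₁| - |branch f i y₂|)| := by
  cases i
  · rw [abs_of_nonpos (S.false_mem _ h₁).2, abs_of_nonpos (S.false_mem _ h₂).2,
      ← abs_neg]
    congr 1
    ring
  · rw [abs_of_nonneg (S.true_mem _ h₁).1, abs_of_nonneg (S.true_mem _ h₂).1]

theorem branch_mapsTo (S : ControlledBranches P f ρ) (i : Bool) :
    MapsTo (branch f i) (Icc (-1) 1) (Icc (-1) 1) := by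
  intro y hy
  cases i
  · exact ⟨(S.false_mem y hy).1, (S.false_mem y hy).2.trans zero_le_one⟩
  · exact ⟨by linarith [(S.true_mem y hy).1], (S.true_mem y hy).2⟩

theorem branch_injOn (S : ControlledBranches P f ρ) (i : Bool) :
    InjOn (branch f i) (Icc (-1) 1) :=
  fun _ hx _ hy h => (S.anti i).injOn hx hy (congrArg _ h)

theorem branch_false_strictMonoOn (S : ControlledBranches P f ρ) :
    StrictMonoOn (branch f false) (Icc (-1) 1) := by
  intro x hx y hy hxy
  have := S.anti false hx hy hxy
  simp only [abs_of_nonpos (S.false_mem _ hx).2, abs_of_nonpos (S.false_mem _ hy).2] at this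
  linarith

theorem branch_true_strictAntiOn (S : ControlledBranches P f ρ) :
    StrictAntiOn (branch f true) (Icc (-1) 1) := by
  intro x hx y hy hxy
  have := S.anti true hx hy hxy
  simpa only [abs_of_nonneg (S.true_mem _ hx).1, abs_of_nonneg (S.true_mem _ hy).1] using this

theorem branch_false_neg_one (S : ControlledBranches P f ρ) : branch f false (-1) = -1 := by
  have h := S.abs_neg_one false
  rw [abs_of_nonpos (S.false_mem (-1) (by simp)).2] at h
  linarith

theorem branch_true_neg_one (S : ControlledBranches P f ρ) : branch f true (-1) = 1 := by
  have h := S.abs_neg_one true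
  rwa [abs_of_nonneg (S.true_mem (-1) (by simp)).1] at h

theorem abs_branch_le_one (S : ControlledBranches P f ρ) (i : Bool) {y : ℝ}
    (hy : y ∈ Icc (-1 : ℝ) 1) : |branch f i y| ≤ 1 :=
  abs_le.2 (S.branch_mapsTo i hy)

theorem gw_mapsTo (S : ControlledBranches P f ρ) (w : List Bool) :
    MapsTo (gw f w) (Icc (-1) 1) (Icc (-1) 1) := by
  induction w with
  | nil => exact mapsTo_id _
  | cons b w ih => exact (S.branch_mapsTo b).comp ih

theorem gw_injOn (S : ControlledBranches P f ρ) (w : List Bool) :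
    InjOn (gw f w) (Icc (-1) 1) := by
  induction w with
  | nil => exact injOn_id _
  | cons b w ih => exact (S.branch_injOn b).comp ih (S.gw_mapsTo w)

theorem Iw_eq (S : ControlledBranches P f ρ) (w : List Bool) :
    Iw f w = uIcc (gw f w (-1)) (gw f w 1) := by
  induction w with
  | nil => simp [Iw, gw]
  | cons b w ih =>
    have : Iw f (b :: w) = branch f b '' Iw f w := by simp only [Iw, gw, image_comp]
    rw [this, ih, S.image_uIcc b _ (S.gw_mapsTo w (by simp)) _ (S.gw_mapsTo w (by simp))]
    rfl

theorem len_Iw (S : ControlledBranches P f ρ) (w : List Bool) :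
    len (Iw f w) = |gw f w 1 - gw f w (-1)| := by
  rw [S.Iw_eq, len, uIcc, Real.volume_Icc, ENNReal.toReal_ofReal (by simp), max_sub_min_eq_abs]

theorem abs_gw_sub_le (S : ControlledBranches P f ρ) (w : List Bool) {x y : ℝ}
    (hx : x ∈ Icc (-1 : ℝ) 1) (hy : y ∈ Icc (-1 : ℝ) 1) :
    |gw f w x - gw f w y| ≤ |gw f w 1 - gw f w (-1)| := by
  have h1 : gw f w x ∈ Iw f w := mem_image_of_mem _ hx
  have h2 : gw f w y ∈ Iw f w := mem_image_of_mem _ hy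
  rw [S.Iw_eq] at h1 h2
  exact abs_sub_le_of_uIcc_subset_uIcc (uIcc_subset_uIcc h2 h1)

theorem abs_gw_sub_le_pow (S : ControlledBranches P f ρ) (w : List Bool) {x y : ℝ}
    (hx : x ∈ Icc (-1 : ℝ) 1) (hy : y ∈ Icc (-1 : ℝ) 1) :
    |gw f w x - gw f w y| ≤ P.C * P.lam ^ w.length :=
  (S.abs_gw_sub_le w hx hy).trans (S.len_Iw w ▸ S.len_le w)

theorem ratio_eq (S : ControlledBranches P f ρ) (a : ℕ → Bool) (n : ℕ) :
    ratio f a n =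
      |gw f (stem a n) (branch f (a 0) 1) - gw f (stem a n) (branch f (a 0) (-1))|
        / |gw f (stem a n) 1 - gw f (stem a n) (-1)| := by
  have : (stem a n ++ [a 0]).dropLast = stem a n := List.dropLast_concat
  rw [ratio, word_eq_stem, this, S.len_Iw, S.len_Iw, gw_append]
  rfl

theorem ratio_mem (S : ControlledBranches P f ρ) (a : ℕ → Bool) (n : ℕ) :
    ratio f a n ∈ Icc (0 : ℝ) 1 := by
  rw [S.ratio_eq]
  exact ⟨by positivity, div_le_one_of_le₀ (S.abs_gw_sub_le _ (S.branch_mapsTo _ (by simp))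
    (S.branch_mapsTo _ (by simp))) (abs_nonneg _)⟩

/-- Close compositions of branches have close ratios. -/
theorem abs_ratio_sub_le (S : ControlledBranches P f ρ) {a b : ℕ → Bool} {m n : ℕ} {η : ℝ}
    (h0 : a 0 = b 0) (H : LogCmp η (gw f (stem a m)) (gw f (stem b n))) :
    |ratio f a m - ratio f b n| ≤ η := by
  rw [S.ratio_eq, S.ratio_eq, ← h0]
  have m₁ := S.branch_mapsTo (a 0) (show (1 : ℝ) ∈ Icc (-1 : ℝ) 1 by simp)
  have m₂ := S.branch_mapsTo (a 0) (show (-1 : ℝ) ∈ Icc (-1 : ℝ) 1 by simp)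
  refine H.abs_ratio_sub_le (S.gw_injOn _) (S.gw_injOn _) m₁ m₂ (by simp) (by simp) ?_
    (by norm_num) (S.abs_gw_sub_le _ m₁ m₂) (S.abs_gw_sub_le _ m₁ m₂)
  intro h
  have := S.branch_injOn (a 0) (by simp) (by simp) h
  norm_num at this

theorem exists_log_slope (S : ControlledBranches P f ρ) (i : Bool) {y₁ y₂ : ℝ}
    (h₁ : y₁ ∈ Icc (-1 : ℝ) 1) (h₂ : y₂ ∈ Icc (-1 : ℝ) 1) (hne : y₁ ≠ y₂) :
    ∃ ξ ∈ Ioo (0 : ℝ) 1, ξ ∈ uIcc |branch f i y₁| |branch f i y₂| ∧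
      Real.log |y₁ - y₂| = (P.γ - 1) * Real.log ξ + Real.log (ρ i ξ)
        + Real.log |branch f i y₁ - branch f i y₂| := by
  wlog hlt : y₁ < y₂ generalizing y₁ y₂
  · obtain ⟨ξ, hξ, hu, he⟩ := this h₂ h₁ hne.symm (lt_of_le_of_ne (not_lt.1 hlt) hne.symm)
    exact ⟨ξ, hξ, by rwa [uIcc_comm], by rwa [abs_sub_comm, abs_sub_comm (branch f i y₁)]⟩
  obtain ⟨ξ, hξ, he⟩ := S.exists_slope i y₁ h₁ y₂ h₂ hlt
  have hξ' : ξ ∈ Ioo (0 : ℝ) 1 :=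
    ⟨(abs_nonneg _).trans_lt hξ.1, hξ.2.trans_le (S.abs_branch_le_one i h₁)⟩
  refine ⟨ξ, hξ', ?_, ?_⟩
  · rw [uIcc_comm]
    exact Icc_subset_uIcc ⟨hξ.1.le, hξ.2.le⟩
  have hρ : 0 < ρ i ξ := P.c_pos.trans_le (S.ρ_mem i ξ hξ').1
  have hd : 0 < |branch f i y₁| - |branch f i y₂| := sub_pos.2 (S.anti i h₁ h₂ hlt)
  rw [abs_sub_comm, abs_of_pos (sub_pos.2 hlt), he, S.abs_sub i h₁ h₂, abs_of_pos hd,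
    Real.log_mul (mul_pos (Real.rpow_pos_of_pos hξ'.1 _) hρ).ne' hd.ne',
    Real.log_mul (Real.rpow_pos_of_pos hξ'.1 _).ne' hρ.ne', Real.log_rpow hξ'.1]

theorem exists_log_pow_slope (S : ControlledBranches P f ρ) (i : Bool) {y₁ y₂ : ℝ}
    (h₁ : y₁ ∈ Icc (-1 : ℝ) 1) (h₂ : y₂ ∈ Icc (-1 : ℝ) 1) (hne : y₁ ≠ y₂) :
    ∃ ξ ∈ Ioo (0 : ℝ) 1, ξ ∈ uIcc |branch f i y₁| |branch f i y₂| ∧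
      Real.log |y₁ - y₂| = Real.log (ρ i ξ) - Real.log P.γ
        + Real.log |(|branch f i y₁| ^ P.γ - |branch f i y₂| ^ P.γ)| := by
  wlog hlt : y₁ < y₂ generalizing y₁ y₂
  · obtain ⟨ξ, hξ, hu, he⟩ := this h₂ h₁ hne.symm (lt_of_le_of_ne (not_lt.1 hlt) hne.symm)
    exact ⟨ξ, hξ, by rwa [uIcc_comm], by rwa [abs_sub_comm, abs_sub_comm (|branch f i y₁| ^ P.γ)]⟩
  obtain ⟨ξ, hξ, he⟩ := S.exists_pow_slope i y₁ h₁ y₂ h₂ hlt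
  have hξ' : ξ ∈ Ioo (0 : ℝ) 1 :=
    ⟨(abs_nonneg _).trans_lt hξ.1, hξ.2.trans_le (S.abs_branch_le_one i h₁)⟩
  refine ⟨ξ, hξ', ?_, ?_⟩
  · rw [uIcc_comm]
    exact Icc_subset_uIcc ⟨hξ.1.le, hξ.2.le⟩
  have hγ : 0 < P.γ := by linarith [P.one_lt_γ]
  have hρ : 0 < ρ i ξ := P.c_pos.trans_le (S.ρ_mem i ξ hξ').1
  have hd : 0 < |branch f i y₁| ^ P.γ - |branch f i y₂| ^ P.γ :=
    sub_pos.2 (Real.rpow_lt_rpow (abs_nonneg _) (S.anti i h₁ h₂ hlt) hγ)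
  rw [abs_sub_comm, abs_of_pos (sub_pos.2 hlt), he, abs_of_pos hd,
    Real.log_mul (div_pos hρ hγ).ne' hd.ne', Real.log_div hρ.ne' hγ.ne']

theorem sub_le_mul_abs (S : ControlledBranches P f ρ) (i : Bool) {y₁ y₂ : ℝ}
    (h₁ : y₁ ∈ Icc (-1 : ℝ) 1) (h₂ : y₂ ∈ Icc (-1 : ℝ) 1) (hlt : y₁ < y₂) :
    y₂ - y₁ ≤ P.M * |branch f i y₁ - branch f i y₂| := by
  obtain ⟨ξ, hξ, he⟩ := S.exists_slope i y₁ h₁ y₂ h₂ hlt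
  have hξ' : ξ ∈ Ioo (0 : ℝ) 1 :=
    ⟨(abs_nonneg _).trans_lt hξ.1, hξ.2.trans_le (S.abs_branch_le_one i h₁)⟩
  have hd : 0 < |branch f i y₁| - |branch f i y₂| := sub_pos.2 (S.anti i h₁ h₂ hlt)
  rw [he, S.abs_sub i h₁ h₂, abs_of_pos hd]
  refine mul_le_mul_of_nonneg_right ?_ hd.le
  have hρ := S.ρ_mem i ξ hξ'
  calc ξ ^ (P.γ - 1) * ρ i ξ ≤ 1 * P.M :=
        mul_le_mul (Real.rpow_le_one hξ'.1.le hξ'.2.le P.γ_sub_one_pos.le) hρ.2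
          (P.c_pos.le.trans hρ.1) zero_le_one
    _ = P.M := one_mul _

/-- Distortion of one branch, in terms of the relative position of the image to `0`. -/
theorem logCmp_branch_comp (S : ControlledBranches P f ρ) (i : Bool) {h : ℝ → ℝ}
    (hm : MapsTo h (Icc (-1) 1) (Icc (-1) 1)) (hi : InjOn h (Icc (-1) 1)) {κ τ : ℝ} (hκ : 0 ≤ κ)
    (hmul : ∀ x ∈ Icc (-1 : ℝ) 1, ∀ y ∈ Icc (-1 : ℝ) 1,
      |branch f i (h x)| ≤ (1 + κ) * |branch f i (h y)|)
    (hadd : ∀ x ∈ Icc (-1 : ℝ) 1, ∀ y ∈ Icc (-1 : ℝ) 1,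
      |branch f i (h x)| ≤ |branch f i (h y)| + τ) :
    LogCmp ((P.γ - 1) * κ + P.K * τ ^ P.α) (branch f i ∘ h) h := by
  intro x hx y hy x' hx' y' hy' hxy hxy'
  obtain ⟨ξ, hξ, hu, he⟩ := S.exists_log_slope i (hm hx) (hm hy) fun e => hxy (hi hx hy e)
  obtain ⟨ξ', hξ', hu', he'⟩ := S.exists_log_slope i (hm hx') (hm hy')
    fun e => hxy' (hi hx' hy' e)
  have ends : ∀ {u v ζ : ℝ}, u ∈ Icc (-1 : ℝ) 1 → v ∈ Icc (-1 : ℝ) 1 →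
      ζ ∈ uIcc |branch f i (h u)| |branch f i (h v)| →
      (∃ z ∈ Icc (-1 : ℝ) 1, ζ ≤ |branch f i (h z)|) ∧
      (∃ z ∈ Icc (-1 : ℝ) 1, |branch f i (h z)| ≤ ζ) := by
    intro u v ζ hu hv hζ
    rcases le_total |branch f i (h u)| |branch f i (h v)| with hle | hle
    · rw [uIcc_of_le hle] at hζ
      exact ⟨⟨v, hv, hζ.2⟩, ⟨u, hu, hζ.1⟩⟩
    · rw [uIcc_of_ge hle] at hζ
      exact ⟨⟨u, hu, hζ.2⟩, ⟨v, hv, hζ.1⟩⟩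
  have cmp : ∀ {u v u' v' ζ ζ' : ℝ}, u ∈ Icc (-1 : ℝ) 1 → v ∈ Icc (-1 : ℝ) 1 →
      u' ∈ Icc (-1 : ℝ) 1 → v' ∈ Icc (-1 : ℝ) 1 →
      ζ ∈ uIcc |branch f i (h u)| |branch f i (h v)| →
      ζ' ∈ uIcc |branch f i (h u')| |branch f i (h v')| → 0 < ζ → 0 < ζ' →
      Real.log ζ - Real.log ζ' ≤ κ ∧ ζ - ζ' ≤ τ := by
    intro u v u' v' ζ ζ' hu hv hu' hv' hζ hζ' p p'
    obtain ⟨z, hz, h1⟩ := (ends hu hv hζ).1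
    obtain ⟨z', hz', h2⟩ := (ends hu' hv' hζ').2
    have h3 := hmul z hz z' hz'
    have h4 := hadd z hz z' hz'
    refine ⟨?_, by linarith⟩
    have h5 : ζ ≤ (1 + κ) * ζ' :=
      h1.trans (h3.trans (mul_le_mul_of_nonneg_left h2 (by linarith)))
    have h6 := Real.log_le_log p h5
    rw [Real.log_mul (by positivity) p'.ne'] at h6
    have h7 := Real.log_le_sub_one_of_pos (show 0 < 1 + κ by linarith)
    linarith
  have c₁ := cmp hx hy hx' hy' hu hu' hξ.1 hξ'.1
  have c₂ := cmp hx' hy' hx hy hu' hu hξ'.1 hξ.1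
  have dρ : |Real.log (ρ i ξ) - Real.log (ρ i ξ')| ≤ P.K * τ ^ P.α :=
    (S.log_ρ i ξ hξ ξ' hξ').trans (mul_le_mul_of_nonneg_left
      (Real.rpow_le_rpow (abs_nonneg _) (abs_le.2 ⟨by linarith [c₂.2], c₁.2⟩) P.α_mem.1.le)
      P.K_pos.le)
  have dl₁ := mul_le_mul_of_nonneg_left c₁.1 P.γ_sub_one_pos.le
  have dl₂ := mul_le_mul_of_nonneg_left c₂.1 P.γ_sub_one_pos.le
  simp only [Function.comp_apply]
  rw [he, he']
  rw [abs_le] at dρ ⊢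
  constructor <;> linarith [dρ.1, dρ.2]

/-- A branch followed by the power `γ` is close to an affine map near the critical point. -/
theorem logCmp_abs_branch_rpow_comp (S : ControlledBranches P f ρ) (i : Bool) {h : ℝ → ℝ}
    (hm : MapsTo h (Icc (-1) 1) (Icc (-1) 1)) (hi : InjOn h (Icc (-1) 1)) {τ : ℝ}
    (hτ : ∀ x ∈ Icc (-1 : ℝ) 1, |branch f i (h x)| ≤ τ) :
    LogCmp (P.K * τ ^ P.α) (fun x => |branch f i (h x)| ^ P.γ) h := by
  intro x hx y hy x' hx' y' hy' hxy hxy'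
  obtain ⟨ξ, hξ, hu, he⟩ := S.exists_log_pow_slope i (hm hx) (hm hy) fun e => hxy (hi hx hy e)
  obtain ⟨ξ', hξ', hu', he'⟩ := S.exists_log_pow_slope i (hm hx') (hm hy')
    fun e => hxy' (hi hx' hy' e)
  have u₁ : ξ ≤ τ := hu.2.trans (sup_le (hτ x hx) (hτ y hy))
  have u₂ : ξ' ≤ τ := hu'.2.trans (sup_le (hτ x' hx') (hτ y' hy'))
  have dρ : |Real.log (ρ i ξ) - Real.log (ρ i ξ')| ≤ P.K * τ ^ P.α :=
    (S.log_ρ i ξ hξ ξ' hξ').trans (mul_le_mul_of_nonneg_left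
      (Real.rpow_le_rpow (abs_nonneg _)
        (abs_le.2 ⟨by linarith [hξ.1], by linarith [hξ'.1]⟩) P.α_mem.1.le) P.K_pos.le)
  rw [he, he']
  rw [abs_le] at dρ ⊢
  constructor <;> linarith [dρ.1, dρ.2]

/-- A bound on the distance to the critical value yields a bound on the distance to the critical
point. -/
theorem abs_branch_le_mul (S : ControlledBranches P f ρ) (i : Bool) {y₁ y₂ κ : ℝ}
    (h₁ : y₁ ∈ Icc (-1 : ℝ) 1) (h₂ : y₂ ∈ Icc (-1 : ℝ) 1) (hκ : 0 ≤ κ)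
    (h : y₂ - y₁ ≤ κ * (1 - y₂)) :
    |branch f i y₁| ≤ (1 + P.M / P.c * κ) * |branch f i y₂| := by
  have hMc : 0 < P.M / P.c := div_pos P.M_pos P.c_pos
  have triv : |branch f i y₂| ≤ (1 + P.M / P.c * κ) * |branch f i y₂| :=
    le_mul_of_one_le_left (abs_nonneg _) (by linarith [mul_nonneg hMc.le hκ])
  rcases le_or_gt y₂ y₁ with hle | hlt
  · exact ((S.anti i).antitoneOn h₂ h₁ hle).trans triv
  have hpos : 0 < 1 - y₂ := by
    rcases eq_or_lt_of_le h₂.2 with e | l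
    · rw [e] at h hlt
      linarith
    · linarith
  have top := S.one_sub_le i y₂ h₂
  have hG : 0 < |branch f i y₂| := by
    rcases eq_or_lt_of_le (abs_nonneg (branch f i y₂)) with e | l
    · rw [← e, Real.zero_rpow (by linarith [P.one_lt_γ])] at top
      linarith
    · exact l
  obtain ⟨ξ, hξ, he⟩ := S.exists_slope i y₁ h₁ y₂ h₂ hlt
  have hξ' : ξ ∈ Ioo (0 : ℝ) 1 := ⟨hG.trans hξ.1, hξ.2.trans_le (S.abs_branch_le_one i h₁)⟩
  have hd : 0 < |branch f i y₁| - |branch f i y₂| := sub_pos.2 (S.anti i h₁ h₂ hlt)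
  set G := |branch f i y₂| with hGdef
  set d := |branch f i y₁| - G with hddef
  have hGp : 0 < G ^ (P.γ - 1) := Real.rpow_pos_of_pos hG _
  have low : G ^ (P.γ - 1) * P.c * d ≤ y₂ - y₁ := by
    rw [he]
    refine mul_le_mul_of_nonneg_right (mul_le_mul
      (Real.rpow_le_rpow hG.le hξ.1.le P.γ_sub_one_pos.le) (S.ρ_mem i ξ hξ').1 P.c_pos.le
      (Real.rpow_pos_of_pos hξ'.1 _).le) hd.le
  have hGγ : G ^ P.γ = G ^ (P.γ - 1) * G := by
    rw [Real.rpow_sub_one hG.ne']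
    field_simp
  have : G ^ (P.γ - 1) * (P.c * d) ≤ G ^ (P.γ - 1) * (κ * P.M * G) := by
    calc G ^ (P.γ - 1) * (P.c * d) ≤ κ * (1 - y₂) := by linarith
      _ ≤ κ * (P.M * G ^ P.γ) := mul_le_mul_of_nonneg_left top hκ
      _ = _ := by rw [hGγ]; ring
  have h2 := le_of_mul_le_mul_left this hGp
  have h3 : d ≤ P.M / P.c * κ * G := by
    rw [div_mul_eq_mul_div, div_mul_eq_mul_div, le_div_iff₀ P.c_pos]
    linarith
  linarith

/-- Distortion of one branch on an interval of the partition, in terms of the relative position of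
the interval to `1`. -/
theorem logCmp_cons (S : ControlledBranches P f ρ) (i : Bool) (v : List Bool) {κ : ℝ}
    (hκ : 0 ≤ κ)
    (h : ∀ x ∈ Icc (-1 : ℝ) 1, ∀ y ∈ Icc (-1 : ℝ) 1,
      gw f v y - gw f v x ≤ κ * (1 - gw f v y)) :
    LogCmp ((P.γ - 1) * (P.M / P.c * κ) + P.K * P.C ^ P.α * P.θ ^ v.length)
      (gw f (i :: v)) (gw f v) := by
  have hMc : 0 < P.M / P.c := div_pos P.M_pos P.c_pos
  have := S.logCmp_branch_comp i (S.gw_mapsTo v) (S.gw_injOn v) (κ := P.M / P.c * κ)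
    (τ := P.C * P.lam ^ (i :: v).length) (by positivity)
    (fun x hx y hy => S.abs_branch_le_mul i (S.gw_mapsTo v hx) (S.gw_mapsTo v hy) hκ (h x hx y hy))
    (fun x hx y hy => by
      have h1 := S.abs_gw_sub_le_pow (i :: v) hx hy
      have h2 := abs_sub_abs_le_abs_sub (gw f (i :: v) x) (gw f (i :: v) y)
      simp only [gw, Function.comp_apply] at h1 h2
      linarith)
  refine this.mono ?_
  rw [P.rpow_C_mul_lam_pow, ← mul_assoc P.K]
  have h1 : P.θ ^ (i :: v).length ≤ P.θ ^ v.length := P.θ_pow_le (by simp)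
  have h2 : 0 ≤ P.K * P.C ^ P.α := by
    have := P.K_pos
    have := P.C_pos
    positivity
  linarith [mul_le_mul_of_nonneg_left h1 h2]

theorem logCmp_cons_false (S : ControlledBranches P f ρ) (i : Bool) (v : List Bool) :
    LogCmp (P.stepConst * P.θ ^ (false :: v).length) (gw f (i :: false :: v))
      (gw f (false :: v)) := by
  have hC := P.C_pos
  have hl := P.lam_mem.1
  have := S.logCmp_cons i (false :: v) (κ := P.C * P.θ ^ (false :: v).length)
    (by have := P.θ_pos; positivity) (fun x hx y hy => by
      have h1 := S.abs_gw_sub_le_pow (false :: v) hy hx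
      have h2 := (S.false_mem _ (S.gw_mapsTo v hy)).2
      have h3 : gw f (false :: v) y = branch f false (gw f v y) := rfl
      have h4 := mul_le_mul_of_nonneg_left (P.lam_pow_le (false :: v).length) hC.le
      have h5 : 0 ≤ P.C * P.θ ^ (false :: v).length := by have := P.θ_pos; positivity
      rw [← h3] at h2
      nlinarith [le_abs_self (gw f (false :: v) y - gw f (false :: v) x)])
  refine this.mono (le_of_eq ?_)
  rw [UniformConstants.stepConst]
  ring

/-- Bounded distortion, with exponential convergence, near the fixed endpoint. -/
theorem logCmp_cons_replicate (S : ControlledBranches P f ρ) (i : Bool) {j m : ℕ} (hj : 1 ≤ j)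
    (hjm : j ≤ m) :
    LogCmp (P.fixConst * P.θ ^ j) (gw f (i :: List.replicate m false))
      (gw f (List.replicate j false)) := by
  have hfix : P.fixConst * (1 - P.θ) = P.stepConst := by
    rw [UniformConstants.fixConst, div_mul_cancel₀ _ P.one_sub_θ_pos.ne']
  have one : ∀ m, 1 ≤ m → ∀ i, LogCmp (P.stepConst * P.θ ^ m)
      (gw f (i :: List.replicate m false)) (gw f (List.replicate m false)) := by
    intro m hm i
    obtain ⟨k, rfl⟩ : ∃ k, m = k + 1 := ⟨m - 1, by omega⟩
    simpa [List.replicate_succ] using S.logCmp_cons_false i (List.replicate k false)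
  have main : LogCmp (P.fixConst * (P.θ ^ j - P.θ ^ m)) (gw f (List.replicate m false))
      (gw f (List.replicate j false)) := by
    induction m, hjm using Nat.le_induction with
    | base => simpa using LogCmp.refl _
    | succ m hm ih =>
      rw [List.replicate_succ]
      refine ((one m (hj.trans hm) false).trans ih).mono (le_of_eq ?_)
      rw [← hfix]
      ring
  refine ((one m (hj.trans hjm) i).trans main).mono ?_
  rw [← hfix]
  have := mul_pos P.fixConst_pos (pow_pos P.θ_pos (m + 1))
  rw [pow_succ] at this
  linarith

theorem gw_replicate_neg_one (S : ControlledBranches P f ρ) (m : ℕ) :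
    gw f (List.replicate m false) (-1) = -1 := by
  induction m with
  | zero => rfl
  | succ m ih => simp [List.replicate_succ, gw, ih, S.branch_false_neg_one]

/-- Distortion close to the critical point, for words with a further digit `1`. -/
theorem logCmp_cons_true (S : ControlledBranches P f ρ) (i : Bool) (m : ℕ) (u : List Bool) :
    LogCmp (P.critConst * P.θ ^ u.length)
      (gw f (i :: true :: (List.replicate m false ++ true :: u)))
      (gw f (true :: (List.replicate m false ++ true :: u))) := by
  have hC := P.C_pos
  have hl := P.lam_mem.1
  have hM := P.M_pos
  have hθ := P.θ_pos
  have neg_one_mem : (-1 : ℝ) ∈ Icc (-1 : ℝ) 1 := by simp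
  obtain ⟨b, hb⟩ : ∃ b, LogCmp P.fixConst (gw f (true :: List.replicate m false))
      (branch f b) := by
    rcases Nat.eq_zero_or_pos m with rfl | hm
    · exact ⟨true, (LogCmp.refl _).mono P.fixConst_pos.le⟩
    · refine ⟨false, (S.logCmp_cons_replicate true le_rfl hm).mono ?_⟩
      have := mul_le_mul_of_nonneg_left P.θ_lt_one.le P.fixConst_pos.le
      simpa using this
  have split : ∀ x, gw f (true :: (List.replicate m false ++ true :: u)) x =
      gw f (true :: List.replicate m false) (gw f (true :: u) x) := by
    intro x
    rw [← List.cons_append, gw_append]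
    rfl
  have at_neg_one : gw f (true :: List.replicate m false) (-1) = 1 := by
    simp [gw, S.gw_replicate_neg_one, S.branch_true_neg_one]
  have := S.logCmp_cons i (true :: (List.replicate m false ++ true :: u))
    (κ := Real.exp P.fixConst * (P.M * P.C) * P.θ ^ u.length) (by positivity)
    (fun x hx y hy => by
      rw [split, split]
      have hx' := S.gw_mapsTo (true :: u) hx
      have hy' := S.gw_mapsTo (true :: u) hy
      have hy0 : 0 ≤ gw f (true :: u) y := (S.true_mem _ (S.gw_mapsTo u hy)).1
      have num : |branch f b (gw f (true :: u) y) - branch f b (gw f (true :: u) x)|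
          ≤ P.C * P.θ ^ u.length := by
        refine (S.abs_gw_sub_le_pow (b :: true :: u) hy hx).trans
          (mul_le_mul_of_nonneg_left ?_ hC.le)
        exact (P.lam_pow_le _).trans (P.θ_pow_le (by simp; omega))
      have den : 1 ≤ P.M * |branch f b (-1) - branch f b (gw f (true :: u) y)| := by
        have := S.sub_le_mul_abs b neg_one_mem hy' (by linarith)
        linarith
      have key := hb.le_of_le (S.gw_injOn _) (S.branch_injOn b) hy' hx' neg_one_mem hy'
        (by linarith) (κ := P.M * (P.C * P.θ ^ u.length)) (num.trans (by
          have : 0 ≤ P.C * P.θ ^ u.length := by positivity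
          nlinarith))
      rw [at_neg_one, abs_of_nonneg (sub_nonneg.2 (S.gw_mapsTo _ hy').2)] at key
      refine (le_abs_self _).trans (key.trans (le_of_eq ?_))
      ring)
  refine this.mono ?_
  have h1 : P.θ ^ (true :: (List.replicate m false ++ true :: u)).length ≤ P.θ ^ u.length :=
    P.θ_pow_le (by simp; omega)
  have h2 : 0 ≤ P.K * P.C ^ P.α := by
    have := P.K_pos
    positivity
  rw [UniformConstants.critConst]
  linarith [mul_le_mul_of_nonneg_left h1 h2]

/-- The digits beyond a digit `1` at position `p` contribute at most `O(θ ^ p)`. -/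
theorem logCmp_stem (S : ControlledBranches P f ρ) {a : ℕ → Bool} {p : ℕ} (hp : 1 ≤ p)
    (hap : a p = true) {k : ℕ} (hk : p + 1 ≤ k) :
    LogCmp (2 * P.tailConst * P.θ ^ p) (gw f (stem a k)) (gw f (stem a (p + 1))) := by
  have htail : P.tailConst * (1 - P.θ) = P.stepConst + P.critConst / P.θ := by
    rw [UniformConstants.tailConst, div_mul_cancel₀ _ P.one_sub_θ_pos.ne']
  have hB := P.tailConst_pos
  have hθ := P.θ_pos
  have hcrit : 0 < P.critConst / P.θ := div_pos P.critConst_pos hθ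
  have hstep := P.stepConst_pos
  suffices H : ∃ l, p ≤ l ∧ l < k ∧ a l = true ∧ (∀ j, l < j → j < k → a j = false) ∧
      LogCmp (P.tailConst * (2 * P.θ ^ p - P.θ ^ l - P.θ ^ k)) (gw f (stem a k))
        (gw f (stem a (p + 1))) by
    obtain ⟨l, -, -, -, -, h⟩ := H
    refine h.mono ?_
    have h1 := mul_pos hB (pow_pos hθ l)
    have h2 := mul_pos hB (pow_pos hθ k)
    linarith
  induction k, hk using Nat.le_induction with
  | base =>
    refine ⟨p, le_rfl, by omega, hap, fun j h1 h2 => by omega, (LogCmp.refl _).mono ?_⟩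
    have := P.θ_pow_le (Nat.le_add_right p 1)
    exact mul_nonneg hB.le (by linarith)
  | succ k hk ih =>
    obtain ⟨l, hpl, hlk, hal, hz, h⟩ := ih
    obtain ⟨k, rfl⟩ : ∃ k', k = k' + 1 := ⟨k - 1, by omega⟩
    cases hak : a (k + 1) with
    | false =>
      refine ⟨l, hpl, by omega, hal, fun j h1 h2 => ?_, ?_⟩
      · rcases eq_or_ne j (k + 1) with rfl | hne
        · exact hak
        · exact hz j h1 (by omega)
      · have one := S.logCmp_cons_false (a (k + 1 + 1)) (stem a k)
        rw [← hak] at one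
        refine (LogCmp.trans one h).mono ?_
        have e : (a (k + 1) :: stem a k).length = k + 1 := by simp [stem_length]
        rw [e]
        have h1 : P.stepConst ≤ P.tailConst * (1 - P.θ) := by linarith
        have h2 := mul_le_mul_of_nonneg_right h1 (pow_pos hθ (k + 1)).le
        rw [pow_succ P.θ (k + 1)]
        linarith
    | true =>
      refine ⟨k + 1, by omega, by omega, hak, fun j h1 h2 => by omega, ?_⟩
      obtain ⟨l, rfl⟩ : ∃ l', l = l' + 1 := ⟨l - 1, by omega⟩
      have one := S.logCmp_cons_true (a (k + 1 + 1)) (k - (l + 1)) (stem a l)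
      have e1 : true :: stem a l = stem a (l + 1) := by rw [stem, hal]
      have e2 : List.replicate (k - (l + 1)) false ++ stem a (l + 1) = stem a k := by
        rw [← stem_add_eq fun j h1 h2 => hz j h1 (by omega)]
        congr 1
        omega
      rw [e1, e2, ← hak] at one
      refine (LogCmp.trans one h).mono ?_
      rw [stem_length]
      have h1 : P.critConst / P.θ ≤ P.tailConst * (1 - P.θ) := by linarith
      have h2 := mul_le_mul_of_nonneg_right h1 (pow_pos hθ (l + 1)).le
      have h3 : P.critConst / P.θ * P.θ ^ (l + 1) = P.critConst * P.θ ^ l := by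
        rw [pow_succ]
        field_simp
      have h4 : P.θ ^ (k + 1) ≤ P.θ ^ (l + 1) * P.θ := by
        rw [← pow_succ]
        exact P.θ_pow_le (by omega)
      have h5 := mul_le_mul_of_nonneg_left h4 hB.le
      have h6 := mul_pos hB (pow_pos hθ (k + 1 + 1))
      have h7 := mul_le_mul_of_nonneg_left (P.θ_pow_le (Nat.le_add_right (k + 1) 1)) hB.le
      linarith

theorem abs_ratio_sub_ratio_le (S : ControlledBranches P f ρ) {a : ℕ → Bool} {p : ℕ} (hp : 1 ≤ p)
    (hap : a p = true) {k : ℕ} (hk : p + 1 ≤ k) :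
    |ratio f a k - ratio f a (p + 1)| ≤ 2 * P.tailConst * P.θ ^ p :=
  S.abs_ratio_sub_le rfl (S.logCmp_stem hp hap hk)

theorem gw_replicate_strictMonoOn (S : ControlledBranches P f ρ) (m : ℕ) :
    StrictMonoOn (gw f (List.replicate m false)) (Icc (-1) 1) := by
  induction m with
  | zero => exact strictMono_id.strictMonoOn _
  | succ m ih => exact S.branch_false_strictMonoOn.comp ih (S.gw_mapsTo _)

/-- If the critical value is `1`, the map `i 1 0 ⋯ 0` converges exponentially fast, up to affine
maps, as the number of zeros increases. -/
theorem logCmp_critical (S : ControlledBranches P f ρ) (h0 : ∀ i, branch f i 1 = 0) (i i' : Bool)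
    {j m m' : ℕ} (hj : 1 ≤ j) (hm : j ≤ m) (hm' : j ≤ m') :
    LogCmp (P.powConst * P.θ ^ j) (gw f (i :: true :: List.replicate m false))
      (gw f (i' :: true :: List.replicate m' false)) := by
  have hγ : 0 < P.γ := by linarith [P.one_lt_γ]
  have hKC : 0 < P.K * P.C ^ P.α := by
    have := P.K_pos
    have := P.C_pos
    positivity
  have bound : ∀ i m, j ≤ m → LogCmp (P.K * P.C ^ P.α * P.θ ^ j)
      (fun x => |gw f (i :: true :: List.replicate m false) x| ^ P.γ)
      (gw f (true :: List.replicate m false)) := by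
    intro i m hm
    refine (S.logCmp_abs_branch_rpow_comp i (S.gw_mapsTo (true :: List.replicate m false))
      (S.gw_injOn _) (τ := P.C * P.lam ^ (i :: true :: List.replicate m false).length) ?_).mono ?_
    · intro x hx
      have h1 := S.abs_gw_sub_le_pow (i :: true :: List.replicate m false) hx
        (show (-1 : ℝ) ∈ Icc (-1 : ℝ) 1 by simp)
      have h2 : gw f (i :: true :: List.replicate m false) (-1) = 0 := by
        simp [gw, S.gw_replicate_neg_one, S.branch_true_neg_one, h0]
      rwa [h2, sub_zero] at h1
    · rw [P.rpow_C_mul_lam_pow, ← mul_assoc]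
      exact mul_le_mul_of_nonneg_left (P.θ_pow_le (by simp; omega)) hKC.le
  have mono : ∀ i m, StrictMonoOn
      (fun x => |gw f (i :: true :: List.replicate m false) x| ^ P.γ) (Icc (-1) 1) := by
    intro i m x hx y hy hxy
    refine Real.rpow_lt_rpow (abs_nonneg _) (S.anti i (S.gw_mapsTo _ hy) (S.gw_mapsTo _ hx) ?_) hγ
    exact S.branch_true_strictAntiOn (S.gw_mapsTo _ hx) (S.gw_mapsTo _ hy)
      (S.gw_replicate_strictMonoOn m hx hy hxy)
  have zero : ∀ i m, |gw f (i :: true :: List.replicate m false) (-1)| ^ P.γ = 0 := by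
    intro i m
    simp [gw, S.gw_replicate_neg_one, S.branch_true_neg_one, h0, hγ.ne']
  have fix := (S.logCmp_cons_replicate true hj hm).trans (S.logCmp_cons_replicate true hj hm').symm
  have total := ((bound i m hm).trans fix).trans (bound i' m' hm').symm
  have hpos : 0 ≤ P.K * P.C ^ P.α * P.θ ^ j + (P.fixConst * P.θ ^ j + P.fixConst * P.θ ^ j)
      + P.K * P.C ^ P.α * P.θ ^ j := by
    have := P.fixConst_pos
    have := P.θ_pos
    positivity
  have fin := total.rpow (s := 1 / P.γ) ⟨by positivity, (div_le_one hγ).2 P.one_lt_γ.le⟩ hpos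
    (mono i m) (mono i' m') (zero i m) (zero i' m')
  intro x hx y hy x' hx' y' hy' hxy hxy'
  have key := fin x hx y hy x' hx' y' hy' hxy hxy'
  have root : ∀ t : ℝ, (|t| ^ P.γ) ^ (1 / P.γ) = |t| := fun t => by
    rw [← Real.rpow_mul (abs_nonneg t), mul_one_div_cancel hγ.ne', Real.rpow_one]
  simp only [root] at key
  have unabs : ∀ i m, ∀ u ∈ Icc (-1 : ℝ) 1, ∀ v ∈ Icc (-1 : ℝ) 1,
      |(|gw f (i :: true :: List.replicate m false) u|
        - |gw f (i :: true :: List.replicate m false) v|)|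
      = |gw f (i :: true :: List.replicate m false) u
        - gw f (i :: true :: List.replicate m false) v| := fun i m u hu v hv =>
    (S.abs_sub i (S.gw_mapsTo _ hu) (S.gw_mapsTo _ hv)).symm
  rw [unabs i m x hx y hy, unabs i' m' x hx y hy, unabs i m x' hx' y' hy',
    unabs i' m' x' hx' y' hy'] at key
  refine key.trans (le_of_eq ?_)
  rw [UniformConstants.powConst]
  ring

/-- If the critical value is `1`, dual points sharing their first digits up to a long string of
zeros have close ratios just after the next digit `1`. -/
theorem abs_ratio_sub_ratio_critical_le (S : ControlledBranches P f ρ)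
    (h0 : ∀ i, branch f i 1 = 0) {a b : ℕ → Bool} {h j m m' : ℕ} (hj : 1 ≤ j) (hm : j ≤ m)
    (hm' : j ≤ m') (hab : ∀ k ≤ h, a k = b k)
    (ha : ∀ k, h < k → k ≤ h + m → a k = false) (hb : ∀ k, h < k → k ≤ h + m' → b k = false)
    (ha1 : a (h + m + 1) = true) (hb1 : b (h + m' + 1) = true) :
    |ratio f a (h + m + 2) - ratio f b (h + m' + 2)| ≤ P.powConst * P.θ ^ j := by
  refine S.abs_ratio_sub_le (hab 0 (Nat.zero_le _)) ?_
  have e : ∀ {a : ℕ → Bool} {m : ℕ}, (∀ k, h < k → k ≤ h + m → a k = false) →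
      a (h + m + 1) = true →
      gw f (stem a (h + m + 2))
        = gw f (a (h + m + 2) :: true :: List.replicate m false) ∘ gw f (stem a h) := by
    intro a m hz h1
    rw [← gw_append, stem, stem, h1, stem_add_eq hz]
    rfl
  rw [e ha ha1, e hb hb1, stem_congr hab]
  exact (S.logCmp_critical h0 _ _ hj hm hm').comp (S.gw_mapsTo _) (S.gw_injOn _)

end ControlledBranches

/-- The sign of the side of the critical point on which a branch takes its values. -/
def branchSign : Bool → ℝ
  | false => -1
  | true => 1

theorem abs_branchSign (i : Bool) : |branchSign i| = 1 := by
  cases i <;> norm_num [branchSign]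

theorem Real.abs_log_sub_log_le {c a b : ℝ} (hc : 0 < c) (ha : c ≤ a) (hb : c ≤ b) :
    |Real.log a - Real.log b| ≤ |a - b| / c := by
  have aux : ∀ {a b : ℝ}, c ≤ a → c ≤ b → Real.log a - Real.log b ≤ |a - b| / c := by
    intro a b ha hb
    have ha' := hc.trans_le ha
    have hb' := hc.trans_le hb
    have h := Real.log_le_sub_one_of_pos (div_pos ha' hb')
    rw [Real.log_div ha'.ne' hb'.ne'] at h
    have h1 : a / b - 1 = (a - b) / b := by field_simp
    have h2 : (a - b) / b ≤ |a - b| / b := by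
      gcongr
      exact le_abs_self _
    have h3 : |a - b| / b ≤ |a - b| / c := by gcongr
    linarith
  refine abs_le.2 ⟨?_, aux ha hb⟩
  have := aux hb ha
  rw [abs_sub_comm] at this
  linarith

namespace GoodFamily

variable (F : GoodFamily)

/-- The restriction of `f ε` to one side of the critical point, as a function on `[0, 1]`. -/
noncomputable def fold (ε : ℝ) (i : Bool) (t : ℝ) : ℝ := F.f ε (branchSign i * t)

/-- The density of `f ε` with respect to `|x| ^ γ`, up to the factor `γ`. -/
noncomputable def density (ε : ℝ) (i : Bool) (t : ℝ) : ℝ :=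
  |F.f' ε (branchSign i * t)| / t ^ (F.gamma - 1)

variable {F} {ε : ℝ}

theorem fold_strictAntiOn (hε : ε ∈ Icc 0 F.eps0) (i : Bool) :
    StrictAntiOn (F.fold ε i) (Icc 0 1) := by
  intro s hs t ht hst
  cases i
  · exact F.mono ε hε (by simp [branchSign, ht.1, ht.2]) (by simp [branchSign, hs.1, hs.2])
      (by simpa [branchSign] using hst)
  · simpa [fold, branchSign] using F.anti ε hε hs ht hst

theorem fold_one (hε : ε ∈ Icc 0 F.eps0) (i : Bool) : F.fold ε i 1 = -1 := by
  cases i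
  · simpa [fold, branchSign] using F.map_neg_one ε hε
  · simpa [fold, branchSign] using F.map_one ε hε

theorem fold_zero (hε : ε ∈ Icc 0 F.eps0) (i : Bool) : F.fold ε i 0 = 1 + ε := by
  simpa [fold] using F.map_zero ε hε

theorem sign_mul_mem {t : ℝ} (i : Bool) (ht : t ∈ Icc (0 : ℝ) 1) :
    branchSign i * t ∈ Icc (-1 : ℝ) 1 := by
  rw [mem_Icc, ← abs_le, abs_mul, abs_branchSign, one_mul, abs_of_nonneg ht.1]
  exact ht.2

theorem fold_continuousOn (hε : ε ∈ Icc 0 F.eps0) (i : Bool) :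
    ContinuousOn (F.fold ε i) (Icc 0 1) := by
  have h : ContinuousOn (F.f ε) (Icc (-1) 1) :=
    fun x hx => (F.deriv_f ε hε x hx).continuousWithinAt
  exact h.comp (by fun_prop) fun t ht => sign_mul_mem i ht

theorem fold_hasDerivAt (hε : ε ∈ Icc 0 F.eps0) (i : Bool) {t : ℝ} (ht : t ∈ Ioo (0 : ℝ) 1) :
    HasDerivAt (F.fold ε i) (F.f' ε (branchSign i * t) * branchSign i) t := by
  have hlt : |branchSign i * t| < 1 := by
    rw [abs_mul, abs_branchSign, one_mul, abs_of_pos ht.1]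
    exact ht.2
  have h := (F.deriv_f ε hε _ (sign_mul_mem i ⟨ht.1.le, ht.2.le⟩)).hasDerivAt
    (Icc_mem_nhds (abs_lt.1 hlt).1 (abs_lt.1 hlt).2)
  have h' := h.comp t ((hasDerivAt_id t).const_mul (branchSign i))
  rw [mul_one] at h'
  exact h'

theorem fold_slope (hε : ε ∈ Icc 0 F.eps0) (i : Bool) {s t : ℝ} (hs : 0 ≤ s) (hst : s < t)
    (ht : t ≤ 1) :
    ∃ ξ ∈ Ioo s t,
      F.fold ε i s - F.fold ε i t = ξ ^ (F.gamma - 1) * F.density ε i ξ * (t - s) := by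
  obtain ⟨ξ, hξ, he⟩ := exists_hasDerivAt_eq_slope (F.fold ε i) _ hst
    ((fold_continuousOn hε i).mono (Icc_subset_Icc hs ht))
    (fun x hx => fold_hasDerivAt hε i ⟨hs.trans_lt hx.1, hx.2.trans_le ht⟩)
  refine ⟨ξ, hξ, ?_⟩
  have hξ0 : 0 < ξ := hs.trans_lt hξ.1
  have hd : 0 < t - s := sub_pos.2 hst
  have hneg : 0 < F.fold ε i s - F.fold ε i t :=
    sub_pos.2 (fold_strictAntiOn hε i ⟨hs, hst.le.trans ht⟩ ⟨hs.trans hst.le, ht⟩ hst)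
  have h := congrArg abs he
  rw [abs_mul, abs_branchSign, mul_one, abs_div, abs_of_pos hd, abs_sub_comm, abs_of_pos hneg] at h
  rw [density, h]
  have := (Real.rpow_pos_of_pos hξ0 (F.gamma - 1)).ne'
  field_simp

theorem fold_pow_slope (hε : ε ∈ Icc 0 F.eps0) (i : Bool) {s t : ℝ} (hs : 0 ≤ s) (hst : s < t)
    (ht : t ≤ 1) :
    ∃ ξ ∈ Ioo s t, F.fold ε i s - F.fold ε i t
      = F.density ε i ξ / F.gamma * (t ^ F.gamma - s ^ F.gamma) := by
  have hγ : 0 < F.gamma := by linarith [F.one_lt_gamma]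
  obtain ⟨ξ, hξ, he⟩ := exists_ratio_hasDerivAt_eq_ratio_slope (F.fold ε i) _ hst
    ((fold_continuousOn hε i).mono (Icc_subset_Icc hs ht))
    (fun x hx => fold_hasDerivAt hε i ⟨hs.trans_lt hx.1, hx.2.trans_le ht⟩)
    (fun x => x ^ F.gamma) (fun x => F.gamma * x ^ (F.gamma - 1))
    (Real.continuous_rpow_const hγ.le).continuousOn
    (fun x hx => Real.hasDerivAt_rpow_const (Or.inl (hs.trans_lt hx.1).ne'))
  refine ⟨ξ, hξ, ?_⟩
  have hξ0 : 0 < ξ := hs.trans_lt hξ.1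
  have hp := Real.rpow_pos_of_pos hξ0 (F.gamma - 1)
  have hd : 0 < t ^ F.gamma - s ^ F.gamma := sub_pos.2 (Real.rpow_lt_rpow hs hst hγ)
  have hneg : 0 < F.fold ε i s - F.fold ε i t :=
    sub_pos.2 (fold_strictAntiOn hε i ⟨hs, hst.le.trans ht⟩ ⟨hs.trans hst.le, ht⟩ hst)
  have h := congrArg abs he
  rw [abs_mul, abs_mul, abs_mul, abs_branchSign, mul_one, abs_of_pos hd, abs_sub_comm,
    abs_of_pos hneg, abs_of_pos (mul_pos hγ hp)] at h
  rw [density]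
  field_simp
  linarith

theorem branch_spec (hε : ε ∈ Icc 0 F.eps0) (i : Bool) {y : ℝ} (hy : y ∈ Icc (-1 : ℝ) 1) :
    |branch (F.f ε) i y| ∈ Icc (0 : ℝ) 1 ∧
      branch (F.f ε) i y = branchSign i * |branch (F.f ε) i y| ∧
      F.fold ε i |branch (F.f ε) i y| = y := by
  have hiv : y ∈ F.fold ε i '' Icc 0 1 := by
    refine intermediate_value_Icc' zero_le_one (fold_continuousOn hε i) ?_
    rw [fold_one hε, fold_zero hε]
    exact ⟨hy.1, by linarith [hy.2, hε.1]⟩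
  obtain ⟨t, ht, hty⟩ := hiv
  cases i
  · have hex : ∃ x ∈ Icc (-1 : ℝ) 0, F.f ε x = y :=
      ⟨-t, ⟨by linarith [ht.2], by linarith [ht.1]⟩, by simpa [fold, branchSign] using hty⟩
    have hm : branch (F.f ε) false y ∈ Icc (-1 : ℝ) 0 := Function.invFunOn_mem hex
    have he : F.f ε (branch (F.f ε) false y) = y := Function.invFunOn_eq hex
    rw [abs_of_nonpos hm.2]
    refine ⟨⟨by linarith [hm.2], by linarith [hm.1]⟩, by simp [branchSign], ?_⟩
    simpa [fold, branchSign] using he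
  · have hex : ∃ x ∈ Icc (0 : ℝ) 1, F.f ε x = y :=
      ⟨t, ht, by simpa [fold, branchSign] using hty⟩
    have hm : branch (F.f ε) true y ∈ Icc (0 : ℝ) 1 := Function.invFunOn_mem hex
    have he : F.f ε (branch (F.f ε) true y) = y := Function.invFunOn_eq hex
    rw [abs_of_nonneg hm.1]
    refine ⟨hm, by simp [branchSign], ?_⟩
    simpa [fold, branchSign] using he

theorem abs_branch_eq (hε : ε ∈ Icc 0 F.eps0) (i : Bool) {t : ℝ} (ht : t ∈ Icc (0 : ℝ) 1)
    (hy : F.fold ε i t ∈ Icc (-1 : ℝ) 1) : |branch (F.f ε) i (F.fold ε i t)| = t := by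
  obtain ⟨h1, -, h3⟩ := branch_spec hε i hy
  exact (fold_strictAntiOn hε i).injOn h1 ht h3

theorem abs_branch_strictAntiOn (hε : ε ∈ Icc 0 F.eps0) (i : Bool) :
    StrictAntiOn (fun y => |branch (F.f ε) i y|) (Icc (-1) 1) := by
  intro x hx y hy hxy
  obtain ⟨h1, -, h3⟩ := branch_spec hε i hx
  obtain ⟨h1', -, h3'⟩ := branch_spec hε i hy
  rw [← (fold_strictAntiOn hε i).lt_iff_gt h1 h1', h3, h3']
  exact hxy

theorem false_mem (hε : ε ∈ Icc 0 F.eps0) {y : ℝ} (hy : y ∈ Icc (-1 : ℝ) 1) :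
    branch (F.f ε) false y ∈ Icc (-1 : ℝ) 0 := by
  obtain ⟨h1, h2, -⟩ := branch_spec hε false hy
  rw [h2]
  simpa [branchSign] using h1.2

theorem true_mem (hε : ε ∈ Icc 0 F.eps0) {y : ℝ} (hy : y ∈ Icc (-1 : ℝ) 1) :
    branch (F.f ε) true y ∈ Icc (0 : ℝ) 1 := by
  obtain ⟨h1, h2, -⟩ := branch_spec hε true hy
  rw [h2]
  simpa [branchSign] using h1.2

theorem apply_branch (hε : ε ∈ Icc 0 F.eps0) (i : Bool) {y : ℝ} (hy : y ∈ Icc (-1 : ℝ) 1) :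
    F.f ε (branch (F.f ε) i y) = y := by
  obtain ⟨-, h2, h3⟩ := branch_spec hε i hy
  rw [fold, ← h2] at h3
  exact h3

theorem branch_image_uIcc (hε : ε ∈ Icc 0 F.eps0) (i : Bool) {p q : ℝ}
    (hp : p ∈ Icc (-1 : ℝ) 1) (hq : q ∈ Icc (-1 : ℝ) 1) :
    branch (F.f ε) i '' uIcc p q = uIcc (branch (F.f ε) i p) (branch (F.f ε) i q) := by
  have hsub : uIcc p q ⊆ Icc (-1) 1 := uIcc_subset_Icc hp hq
  have hanti := (abs_branch_strictAntiOn hε i).antitoneOn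
  cases i
  · have hm : MonotoneOn (branch (F.f ε) false) (Icc (-1) 1) := by
      intro x hx y hy hxy
      have := hanti hx hy hxy
      simp only [abs_of_nonpos (false_mem hε hx).2, abs_of_nonpos (false_mem hε hy).2] at this
      linarith
    refine Subset.antisymm (hm.mono hsub).image_uIcc_subset fun x hx => ?_
    have hside : uIcc (branch (F.f ε) false p) (branch (F.f ε) false q) ⊆ Icc (-1) 0 :=
      uIcc_subset_Icc (false_mem hε hp) (false_mem hε hq)
    have hfx := ((F.mono ε hε).monotoneOn.mono hside).image_uIcc_subset (mem_image_of_mem _ hx)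
    rw [apply_branch hε _ hp, apply_branch hε _ hq] at hfx
    exact ⟨F.f ε x, hfx, (F.mono ε hε).injOn (false_mem hε (hsub hfx)) (hside hx)
      (apply_branch hε _ (hsub hfx))⟩
  · have hm : AntitoneOn (branch (F.f ε) true) (Icc (-1) 1) := by
      intro x hx y hy hxy
      have := hanti hx hy hxy
      simpa only [abs_of_nonneg (true_mem hε hx).1, abs_of_nonneg (true_mem hε hy).1] using this
    refine Subset.antisymm (hm.mono hsub).image_uIcc_subset fun x hx => ?_
    have hside : uIcc (branch (F.f ε) true p) (branch (F.f ε) true q) ⊆ Icc 0 1 :=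
      uIcc_subset_Icc (true_mem hε hp) (true_mem hε hq)
    have hfx := ((F.anti ε hε).antitoneOn.mono hside).image_uIcc_subset (mem_image_of_mem _ hx)
    rw [apply_branch hε _ hp, apply_branch hε _ hq] at hfx
    exact ⟨F.f ε x, hfx, (F.anti ε hε).injOn (true_mem hε (hsub hfx)) (hside hx)
      (apply_branch hε _ (hsub hfx))⟩

theorem len_Iw_le (hε : ε ∈ Icc 0 F.eps0) (w : List Bool) :
    len (Iw (F.f ε) w) ≤ (F.C0 + 2) / F.lam * F.lam ^ w.length := by
  have hl := F.lam_mem.1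
  have hC := F.C0_pos
  have mono : ∀ {s : Set ℝ} {a b : ℝ}, a ≤ b → s ⊆ Icc a b → len s ≤ b - a := by
    intro s a b hab hs
    have := ENNReal.toReal_mono (by simp) (measure_mono (μ := volume) hs)
    rwa [Real.volume_Icc, ENNReal.toReal_ofReal (by linarith)] at this
  match w with
  | [] =>
    have h1 : len (Iw (F.f ε) []) ≤ 1 - (-1) := mono (by norm_num) (by simp [Iw, gw])
    have h2 : 2 ≤ (F.C0 + 2) / F.lam := by
      rw [le_div_iff₀ hl]
      nlinarith [F.lam_mem.2]
    simpa using h1.trans (by linarith)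
  | [b] =>
    have h1 : len (Iw (F.f ε) [b]) ≤ 1 := by
      cases b
      · refine (mono (a := -1) (b := 0) (by norm_num) ?_).trans (by norm_num)
        rintro _ ⟨y, hy, rfl⟩
        exact false_mem hε hy
      · refine (mono (a := 0) (b := 1) (by norm_num) ?_).trans (by norm_num)
        rintro _ ⟨y, hy, rfl⟩
        exact true_mem hε hy
    have h2 : (F.C0 + 2) / F.lam * F.lam ^ [b].length = F.C0 + 2 := by
      simp only [List.length_singleton, pow_one]
      field_simp
    linarith
  | b :: b' :: w =>
    have h1 := F.decay ε hε (w.length + 1) (by omega) (b :: b' :: w) (by simp)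
    have h2 : (F.C0 + 2) / F.lam * F.lam ^ (b :: b' :: w).length
        = (F.C0 + 2) * F.lam ^ (w.length + 1) := by
      simp only [List.length_cons]
      rw [pow_succ _ (w.length + 1)]
      field_simp
    rw [h2]
    have := pow_pos hl (w.length + 1)
    nlinarith

theorem exists_density_bounds (F : GoodFamily) : ∃ c M : ℝ, 0 < c ∧ 0 < M ∧
    ∀ ε ∈ Icc 0 F.eps0, ∀ i, ∀ ξ ∈ Ioo (0 : ℝ) 1, F.density ε i ξ ∈ Icc c M := by
  have bounds : ∀ {R : ℝ → ℝ → ℝ} {a b : ℝ},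
      ContinuousOn (fun p : ℝ × ℝ => R p.1 p.2) (Icc 0 F.eps0 ×ˢ Icc a b) →
      (∀ ε ∈ Icc 0 F.eps0, ∀ x ∈ Icc a b, R ε x ≠ 0) →
      ∃ B > 0, ∀ ε ∈ Icc 0 F.eps0, ∀ x ∈ Icc a b, |R ε x| ∈ Icc B⁻¹ B := by
    intro R a b hc hne
    have hK : IsCompact (Icc 0 F.eps0 ×ˢ Icc a b) := isCompact_Icc.prod isCompact_Icc
    obtain ⟨B₁, h₁⟩ := hK.exists_bound_of_continuousOn hc
    obtain ⟨B₂, h₂⟩ := hK.exists_bound_of_continuousOn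
      (hc.inv₀ fun p hp => hne p.1 hp.1 p.2 hp.2)
    have hB : 0 < max (max B₁ B₂) 1 := lt_max_of_lt_right one_pos
    refine ⟨max (max B₁ B₂) 1, hB, fun ε hε x hx => ?_⟩
    have k₁ := h₁ (ε, x) ⟨hε, hx⟩
    have k₂ := h₂ (ε, x) ⟨hε, hx⟩
    simp only [Real.norm_eq_abs, Pi.inv_apply, abs_inv] at k₁ k₂
    refine ⟨inv_le_of_inv_le₀ (abs_pos.2 (hne ε hε x hx)) (k₂.trans ?_), k₁.trans ?_⟩
    · exact (le_max_right _ _).trans (le_max_left _ _)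
    · exact (le_max_left _ _).trans (le_max_left _ _)
  obtain ⟨B₁, hB₁, h₁⟩ := bounds F.Rneg_cont F.Rneg_ne
  obtain ⟨B₂, hB₂, h₂⟩ := bounds F.Rpos_cont F.Rpos_ne
  refine ⟨min B₁⁻¹ B₂⁻¹, max B₁ B₂, lt_min (inv_pos.2 hB₁) (inv_pos.2 hB₂),
    lt_max_of_lt_left hB₁, fun ε hε i ξ hξ => ?_⟩
  have habs : ∀ x : ℝ, |x| = ξ → |F.f' ε x| / ξ ^ (F.gamma - 1)
      = |F.f' ε x / |x| ^ (F.gamma - 1)| := by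
    intro x hx
    rw [abs_div, hx, abs_of_pos (Real.rpow_pos_of_pos hξ.1 _)]
  cases i
  · have hx : -ξ ∈ Ico (-1 : ℝ) 0 := ⟨by linarith [hξ.2], by linarith [hξ.1]⟩
    have e : F.density ε false ξ = |F.Rneg ε (-ξ)| := by
      rw [F.Rneg_eq ε hε _ hx, ← habs _ (by rw [abs_neg, abs_of_pos hξ.1])]
      simp [density, branchSign]
    have := h₁ ε hε _ (Ico_subset_Icc_self hx)
    rw [e]
    exact ⟨(min_le_left _ _).trans this.1, this.2.trans (le_max_left _ _)⟩
  · have hx : ξ ∈ Ioc (0 : ℝ) 1 := ⟨hξ.1, hξ.2.le⟩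
    have e : F.density ε true ξ = |F.Rpos ε ξ| := by
      rw [F.Rpos_eq ε hε _ hx, ← habs _ (abs_of_pos hξ.1)]
      simp [density, branchSign]
    have := h₂ ε hε _ (Ioc_subset_Icc_self hx)
    rw [e]
    exact ⟨(min_le_right _ _).trans this.1, this.2.trans (le_max_right _ _)⟩

theorem abs_density_sub_le (hε : ε ∈ Icc 0 F.eps0) (i : Bool) {ξ ξ' : ℝ}
    (hξ : ξ ∈ Ioo (0 : ℝ) 1) (hξ' : ξ' ∈ Ioo (0 : ℝ) 1) :
    |F.density ε i ξ - F.density ε i ξ'| ≤ F.K'' * |ξ - ξ'| ^ F.alpha'' := by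
  have e : ∀ {ζ : ℝ}, ζ ∈ Ioo (0 : ℝ) 1 → F.density ε i ζ =
      |F.f' ε (branchSign i * ζ) / |branchSign i * ζ| ^ (F.gamma - 1)| := by
    intro ζ hζ
    rw [abs_div, abs_mul, abs_branchSign, one_mul, abs_of_pos hζ.1,
      abs_of_pos (Real.rpow_pos_of_pos hζ.1 _), density]
  have d : |branchSign i * ξ - branchSign i * ξ'| = |ξ - ξ'| := by
    rw [← mul_sub, abs_mul, abs_branchSign, one_mul]
  rw [e hξ, e hξ', ← d]
  refine (abs_abs_sub_abs_le_abs_sub _ _).trans ?_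
  cases i
  · exact F.holder''_neg ε hε _ (by simp [branchSign, hξ.1, hξ.2.le]) _
      (by simp [branchSign, hξ'.1, hξ'.2.le])
  · exact F.holder''_pos ε hε _ (by simp [branchSign, hξ.1, hξ.2.le]) _
      (by simp [branchSign, hξ'.1, hξ'.2.le])

/-- A good family has uniformly controlled inverse branches. -/
theorem exists_controlledBranches (F : GoodFamily) : ∃ P : UniformConstants,
    ∀ ε ∈ Icc 0 F.eps0, ControlledBranches P (F.f ε) (F.density ε) := by
  obtain ⟨c, M, hc, hM, hden⟩ := F.exists_density_bounds
  have hl := F.lam_mem.1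
  have hC := F.C0_pos
  let P : UniformConstants :=
    { γ := F.gamma
      α := F.alpha''
      K := F.K'' / c
      c := c
      M := M
      C := (F.C0 + 2) / F.lam
      lam := F.lam
      one_lt_γ := F.one_lt_gamma
      α_mem := F.alpha''_mem
      K_pos := div_pos F.K''_pos hc
      c_pos := hc
      M_pos := hM
      C_pos := by positivity
      lam_mem := F.lam_mem }
  refine ⟨P, fun ε hε => ?_⟩
  refine
    { false_mem := fun y hy => false_mem hε hy
      true_mem := fun y hy => true_mem hε hy
      anti := abs_branch_strictAntiOn hε
      abs_neg_one := fun i => ?_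
      image_uIcc := fun i p hp q hq => branch_image_uIcc hε i hp hq
      exists_slope := fun i y₁ h₁ y₂ h₂ hlt => ?_
      exists_pow_slope := fun i y₁ h₁ y₂ h₂ hlt => ?_
      ρ_mem := hden ε hε
      log_ρ := fun i ξ hξ ξ' hξ' => ?_
      one_sub_le := fun i y hy => ?_
      len_le := len_Iw_le hε }
  · have := abs_branch_eq hε i (t := 1) (by simp) (by rw [fold_one hε]; simp)
    rwa [fold_one hε] at this
  · obtain ⟨a₁, -, e₁⟩ := branch_spec hε i h₁
    obtain ⟨a₂, -, e₂⟩ := branch_spec hε i h₂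
    obtain ⟨ξ, hξ, he⟩ := fold_slope hε i a₂.1 (abs_branch_strictAntiOn hε i h₁ h₂ hlt) a₁.2
    rw [e₁, e₂] at he
    exact ⟨ξ, hξ, he⟩
  · obtain ⟨a₁, -, e₁⟩ := branch_spec hε i h₁
    obtain ⟨a₂, -, e₂⟩ := branch_spec hε i h₂
    obtain ⟨ξ, hξ, he⟩ := fold_pow_slope hε i a₂.1 (abs_branch_strictAntiOn hε i h₁ h₂ hlt) a₁.2
    rw [e₁, e₂] at he
    exact ⟨ξ, hξ, he⟩
  · refine (Real.abs_log_sub_log_le hc (hden ε hε i ξ hξ).1 (hden ε hε i ξ' hξ').1).trans ?_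
    rw [div_mul_eq_mul_div]
    exact div_le_div_of_nonneg_right (abs_density_sub_le hε i hξ hξ') hc.le
  · obtain ⟨a, -, e⟩ := branch_spec hε i hy
    have hγ : 0 < F.gamma := by linarith [F.one_lt_gamma]
    rcases eq_or_lt_of_le a.1 with h0 | hpos
    · rw [← h0, fold_zero hε] at e
      rw [← h0, Real.zero_rpow hγ.ne', mul_zero]
      linarith [hε.1]
    · obtain ⟨ξ, hξ, he⟩ := fold_slope hε i le_rfl hpos a.2
      rw [e, fold_zero hε, sub_zero] at he
      have hξ1 : ξ < 1 := hξ.2.trans_le a.2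
      have hρ := hden ε hε i ξ ⟨hξ.1, hξ1⟩
      have h1 : ξ ^ (F.gamma - 1) ≤ |branch (F.f ε) i y| ^ (F.gamma - 1) :=
        Real.rpow_le_rpow hξ.1.le hξ.2.le (by linarith [F.one_lt_gamma])
      have h2 := mul_le_mul h1 hρ.2 (hc.le.trans hρ.1)
        (Real.rpow_pos_of_pos hpos (F.gamma - 1)).le
      have h3 := mul_le_mul_of_nonneg_right h2 hpos.le
      have h4 : |branch (F.f ε) i y| ^ F.gamma
          = |branch (F.f ε) i y| ^ (F.gamma - 1) * |branch (F.f ε) i y| := by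
        rw [Real.rpow_sub_one hpos.ne']
        field_simp
      rw [h4]
      linarith [hε.1]

theorem zero_mem (F : GoodFamily) : (0 : ℝ) ∈ Icc 0 F.eps0 := ⟨le_rfl, F.eps0_pos.le⟩

theorem branch_zero_one (F : GoodFamily) (i : Bool) : branch (F.f 0) i 1 = 0 := by
  have h : F.fold 0 i 0 = 1 := by rw [fold_zero F.zero_mem, add_zero]
  have := abs_branch_eq F.zero_mem i (t := 0) (by simp) (by rw [h]; simp)
  rwa [h, abs_eq_zero] at this

/-- The inverse branches depend continuously on the parameter. -/
theorem tendsto_branch (F : GoodFamily) (i : Bool) {y : ℝ → ℝ} {y₀ : ℝ}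
    (hy : ∀ ε ∈ Icc 0 F.eps0, y ε ∈ Icc (-1 : ℝ) 1) (hy₀ : y₀ ∈ Icc (-1 : ℝ) 1)
    (hlim : Tendsto y (𝓝[Ioc 0 F.eps0] 0) (𝓝 y₀)) :
    Tendsto (fun ε => branch (F.f ε) i (y ε)) (𝓝[Ioc 0 F.eps0] 0)
      (𝓝 (branch (F.f 0) i y₀)) := by
  have hmem : ∀ᶠ ε in 𝓝[Ioc 0 F.eps0] (0 : ℝ), ε ∈ Icc 0 F.eps0 :=
    eventually_nhdsWithin_of_forall fun ε hε => Ioc_subset_Icc_self hε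
  have hfold : ∀ t ∈ Icc (0 : ℝ) 1, Tendsto (fun ε => F.fold ε i t) (𝓝[Ioc 0 F.eps0] 0)
      (𝓝 (F.fold 0 i t)) := by
    intro t ht
    have hc : ContinuousOn (fun ε => F.f ε (branchSign i * t)) (Icc 0 F.eps0) :=
      F.smooth.continuousOn.comp (f := fun ε : ℝ => (ε, branchSign i * t)) (by fun_prop)
        fun ε hε => ⟨hε, sign_mul_mem i ht⟩
    exact (hc 0 F.zero_mem).mono Ioc_subset_Icc_self
  obtain ⟨a₀, s₀, e₀⟩ := branch_spec F.zero_mem i hy₀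
  have habs : Tendsto (fun ε => |branch (F.f ε) i (y ε)|) (𝓝[Ioc 0 F.eps0] 0)
      (𝓝 |branch (F.f 0) i y₀|) := by
    refine tendsto_order.2 ⟨fun t ht => ?_, fun t ht => ?_⟩
    · rcases lt_or_ge t 0 with hneg | hpos
      · exact Eventually.of_forall fun ε => hneg.trans_le (abs_nonneg _)
      · have htm : t ∈ Icc (0 : ℝ) 1 := ⟨hpos, ht.le.trans a₀.2⟩
        have hlt := fold_strictAntiOn F.zero_mem i htm a₀ ht
        rw [e₀] at hlt
        filter_upwards [hmem, hlim.eventually_lt (hfold t htm) hlt] with ε hε h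
        obtain ⟨a, -, e⟩ := branch_spec hε i (hy ε hε)
        rw [← e] at h
        exact ((fold_strictAntiOn hε i).lt_iff_gt a htm).1 h
    · rcases lt_or_ge 1 t with hbig | hsmall
      · filter_upwards [hmem] with ε hε
        exact (branch_spec hε i (hy ε hε)).1.2.trans_lt hbig
      · have htm : t ∈ Icc (0 : ℝ) 1 := ⟨a₀.1.trans ht.le, hsmall⟩
        have hlt := fold_strictAntiOn F.zero_mem i a₀ htm ht
        rw [e₀] at hlt
        filter_upwards [hmem, (hfold t htm).eventually_lt hlim hlt] with ε hε h
        obtain ⟨a, -, e⟩ := branch_spec hε i (hy ε hε)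
        rw [← e] at h
        exact ((fold_strictAntiOn hε i).lt_iff_gt htm a).1 h
  rw [s₀]
  refine (habs.const_mul (branchSign i)).congr' ?_
  filter_upwards [hmem] with ε hε
  exact (branch_spec hε i (hy ε hε)).2.1.symm

theorem tendsto_gw (F : GoodFamily) {P : UniformConstants}
    (S : ∀ ε ∈ Icc 0 F.eps0, ControlledBranches P (F.f ε) (F.density ε)) (w : List Bool) {x : ℝ}
    (hx : x ∈ Icc (-1 : ℝ) 1) :
    Tendsto (fun ε => gw (F.f ε) w x) (𝓝[Ioc 0 F.eps0] 0) (𝓝 (gw (F.f 0) w x)) := by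
  induction w with
  | nil => exact tendsto_const_nhds
  | cons b w ih =>
    exact F.tendsto_branch b (fun ε hε => (S ε hε).gw_mapsTo w hx)
      ((S 0 F.zero_mem).gw_mapsTo w hx) ih

theorem tendsto_ratio (F : GoodFamily) {P : UniformConstants}
    (S : ∀ ε ∈ Icc 0 F.eps0, ControlledBranches P (F.f ε) (F.density ε)) (a : ℕ → Bool) (n : ℕ) :
    Tendsto (fun ε => ratio (F.f ε) a n) (𝓝[Ioc 0 F.eps0] 0) (𝓝 (ratio (F.f 0) a n)) := by
  have hp : (1 : ℝ) ∈ Icc (-1 : ℝ) 1 := by simp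
  have hm : (-1 : ℝ) ∈ Icc (-1 : ℝ) 1 := by simp
  have len_tendsto : ∀ w, Tendsto (fun ε => len (Iw (F.f ε) w)) (𝓝[Ioc 0 F.eps0] 0)
      (𝓝 (len (Iw (F.f 0) w))) := by
    intro w
    rw [(S 0 F.zero_mem).len_Iw]
    refine ((F.tendsto_gw S w hp).sub (F.tendsto_gw S w hm)).abs.congr' ?_
    exact eventually_nhdsWithin_of_forall fun ε hε =>
      ((S ε (Ioc_subset_Icc_self hε)).len_Iw w).symm
  refine (len_tendsto _).div (len_tendsto _) ?_
  rw [(S 0 F.zero_mem).len_Iw, abs_ne_zero, sub_ne_zero]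
  intro h
  have := (S 0 F.zero_mem).gw_injOn _ hp hm h
  norm_num at this

instance neBot (F : GoodFamily) : (𝓝[Ioc 0 F.eps0] (0 : ℝ)).NeBot := by
  rw [← mem_closure_iff_nhdsWithin_neBot, closure_Ioc F.eps0_pos.ne]
  exact F.zero_mem

/-- The limiting scaling function is approximated by the ratios of `f 0`, with an error governed
by the position of a digit `1`. -/
theorem abs_limit_sub_ratio_le (F : GoodFamily) {P : UniformConstants}
    (S : ∀ ε ∈ Icc 0 F.eps0, ControlledBranches P (F.f ε) (F.density ε))
    {s : ℝ → (ℕ → Bool) → ℝ} (hs : ∀ ε ∈ Ioc 0 F.eps0, IsScalingFun (F.f ε) (s ε))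
    {s0 : (ℕ → Bool) → ℝ}
    (hs0 : ∀ a, Tendsto (fun ε => s ε a) (𝓝[Ioc 0 F.eps0] 0) (𝓝 (s0 a)))
    {a : ℕ → Bool} {p : ℕ} (hp : 1 ≤ p) (hap : a p = true) :
    |s0 a - ratio (F.f 0) a (p + 1)| ≤ 2 * P.tailConst * P.θ ^ p := by
  refine le_of_tendsto ((hs0 a).sub (F.tendsto_ratio S a (p + 1))).abs
    (eventually_nhdsWithin_of_forall fun ε hε => ?_)
  refine le_of_tendsto ((hs ε hε a).sub_const _).abs ?_
  filter_upwards [eventually_ge_atTop (p + 1)] with k hk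
  exact (S ε (Ioc_subset_Icc_self hε)).abs_ratio_sub_ratio_le hp hap hk

theorem limit_mem (F : GoodFamily) {P : UniformConstants}
    (S : ∀ ε ∈ Icc 0 F.eps0, ControlledBranches P (F.f ε) (F.density ε))
    {s : ℝ → (ℕ → Bool) → ℝ} (hs : ∀ ε ∈ Ioc 0 F.eps0, IsScalingFun (F.f ε) (s ε))
    {s0 : (ℕ → Bool) → ℝ}
    (hs0 : ∀ a, Tendsto (fun ε => s ε a) (𝓝[Ioc 0 F.eps0] 0) (𝓝 (s0 a))) (a : ℕ → Bool) :
    s0 a ∈ Icc (0 : ℝ) 1 :=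
  isClosed_Icc.mem_of_tendsto (hs0 a) (eventually_nhdsWithin_of_forall fun ε hε =>
    isClosed_Icc.mem_of_tendsto (hs ε hε a)
      (Eventually.of_forall fun n => (S ε (Ioc_subset_Icc_self hε)).ratio_mem a n))

end GoodFamily

theorem ratio_congr (f : ℝ → ℝ) {a b : ℕ → Bool} {n : ℕ} (h : ∀ k ≤ n, a k = b k) :
    ratio f a n = ratio f b n := by
  rw [ratio, ratio, word_eq_stem, word_eq_stem, stem_congr h, h 0 (Nat.zero_le n)]

theorem exists_digit_one {a : ℕ → Bool} (ha : ¬ EvZero a) (N : ℕ) : ∃ n ≥ N, a n = true := by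
  by_contra! h
  exact ha ⟨N, fun n hn => by simpa using h n hn⟩

theorem exists_first_digit_one {a : ℕ → Bool} (ha : ¬ EvZero a) (N : ℕ) :
    ∃ m, a (N + m) = true ∧ ∀ k < m, a (N + k) = false := by
  classical
  have hex : ∃ m, a (N + m) = true := by
    obtain ⟨n, hn, h⟩ := exists_digit_one ha N
    exact ⟨n - N, by rwa [Nat.add_sub_cancel' hn]⟩
  exact ⟨Nat.find hex, Nat.find_spec hex, fun k hk => by simpa using Nat.find_min hex hk⟩

/-- Theorem A, part 2.2: the limiting scaling function `s₀` (pointwise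
limit as `ε ↓ 0` of the scaling functions `s_ε` of a good family) is continuous at every
point of `ℬ` (dual points with infinitely many ones), and its restriction to `ℬ` is Hölder
continuous. -/
theorem limit_scaling_function_continuous_on_B (F : GoodFamily)
    (s : ℝ → (ℕ → Bool) → ℝ)
    (hs : ∀ ε ∈ Ioc 0 F.eps0, IsScalingFun (F.f ε) (s ε))
    (s0 : (ℕ → Bool) → ℝ)
    (hs0 : ∀ a : ℕ → Bool,
      Tendsto (fun ε => s ε a) (nhdsWithin 0 (Ioc 0 F.eps0)) (nhds (s0 a))) :
    (∀ a : ℕ → Bool, ¬ EvZero a → ContinuousAt s0 a) ∧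
    (∃ C > (0:ℝ), ∃ lam ∈ Ioo (0:ℝ) 1, ∀ a b : ℕ → Bool, ¬ EvZero a → ¬ EvZero b →
      ∀ n : ℕ, (∀ k < n, a k = b k) → |s0 a - s0 b| ≤ C * lam ^ n) := by
  obtain ⟨P, S⟩ := F.exists_controlledBranches
  have hT := P.tailConst_pos
  have hD := P.powConst_pos
  have hθ := P.θ_pos
  have near : ∀ {a b : ℕ → Bool} {p : ℕ}, 1 ≤ p → a p = true → (∀ k ≤ p + 1, a k = b k) →
      |s0 a - s0 b| ≤ 4 * P.tailConst * P.θ ^ p := by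
    intro a b p hp hap hab
    have h1 := F.abs_limit_sub_ratio_le S hs hs0 hp hap
    have h2 := F.abs_limit_sub_ratio_le S hs hs0 hp ((hab p (by omega)).symm.trans hap)
    rw [← ratio_congr _ hab] at h2
    rw [abs_le] at h1 h2 ⊢
    constructor <;> linarith [h1.1, h1.2, h2.1, h2.2]
  refine ⟨fun a ha => ?_, ?_⟩
  · refine Metric.continuousAt_iff'.2 fun δ hδ => ?_
    have hlim : Tendsto (fun p => 4 * P.tailConst * P.θ ^ p) atTop (𝓝 0) := by
      simpa using (tendsto_pow_atTop_nhds_zero_of_lt_one hθ.le P.θ_lt_one).const_mul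
        (4 * P.tailConst)
    obtain ⟨N, hN⟩ := eventually_atTop.1 (hlim.eventually_lt_const hδ)
    obtain ⟨p, hp, hap⟩ := exists_digit_one ha (max N 1)
    have hnhds : ∀ᶠ b in 𝓝 a, ∀ k ∈ Finset.range (p + 2), b k = a k :=
      (eventually_all_finset _).2 fun k _ => (continuous_apply k).continuousAt.eventually
        ((isOpen_discrete {a k}).mem_nhds rfl)
    filter_upwards [hnhds] with b hb
    rw [dist_comm, Real.dist_eq]
    exact (near ((le_max_right _ _).trans hp) hap fun k hk =>
      (hb k (Finset.mem_range.2 (by omega))).symm).trans_lt (hN p ((le_max_left _ _).trans hp))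
  · set lam := √P.θ with hlam
    have hl0 : 0 < lam := Real.sqrt_pos.2 hθ
    have hl1 : lam < 1 := by
      rw [hlam, Real.sqrt_lt' one_pos]
      simpa using P.θ_lt_one
    have hsq : P.θ = lam ^ 2 := (Real.sq_sqrt hθ.le).symm
    refine ⟨(4 * P.tailConst + P.powConst + 1) / lam ^ 4, by positivity, lam, ⟨hl0, hl1⟩,
      fun a b ha hb n hab => ?_⟩
    have reduce : ∀ j, n ≤ 2 * j + 4 → ∀ x, x ≤ (4 * P.tailConst + P.powConst + 1) * P.θ ^ j →
        x ≤ (4 * P.tailConst + P.powConst + 1) / lam ^ 4 * lam ^ n := by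
      intro j hj x hx
      refine hx.trans ?_
      rw [div_mul_eq_mul_div, le_div_iff₀ (by positivity), mul_assoc, hsq, ← pow_mul, ← pow_add]
      exact mul_le_mul_of_nonneg_left (pow_le_pow_of_le_one hl0.le hl1.le hj) (by positivity)
    rcases lt_or_ge n 4 with hn | hn
    · refine reduce 0 (by omega) _ ?_
      have h1 := F.limit_mem S hs hs0 a
      have h2 := F.limit_mem S hs hs0 b
      have : |s0 a - s0 b| ≤ 1 := abs_le.2 ⟨by linarith [h1.1, h2.2], by linarith [h1.2, h2.1]⟩
      simp only [pow_zero, mul_one]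
      linarith
    obtain ⟨j, hj1, hj2, hj3⟩ : ∃ j, 1 ≤ j ∧ 2 * j + 2 ≤ n ∧ n ≤ 2 * j + 4 :=
      ⟨n / 2 - 1, by omega, by omega, by omega⟩
    refine reduce j hj3 _ ?_
    have hpj := pow_pos hθ j
    by_cases hone : ∃ p, j + 1 ≤ p ∧ p + 2 ≤ n ∧ a p = true
    · obtain ⟨p, hp1, hp2, hap⟩ := hone
      refine (near (by omega) hap fun k hk => hab k (by omega)).trans ?_
      have := mul_le_mul_of_nonneg_left (P.θ_pow_le (show j ≤ p by omega)) hT.le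
      have := mul_pos hD hpj
      linarith
    · push Not at hone
      have zeros : ∀ {x : ℕ → Bool} {l : ℕ}, (∀ k < l, x (j + 1 + k) = false) →
          ∀ k, j < k → k ≤ j + l → x k = false := by
        intro x l hx k h1 h2
        have := hx (k - (j + 1)) (by omega)
        rwa [show j + 1 + (k - (j + 1)) = k by omega] at this
      obtain ⟨m, hm1, hm⟩ := exists_first_digit_one ha (j + 1)
      obtain ⟨m', hm1', hm'⟩ := exists_first_digit_one hb (j + 1)
      have hjm : j ≤ m := by
        by_contra! hlt
        exact hone (j + 1 + m) (by omega) (by omega) hm1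
      have hjm' : j ≤ m' := by
        by_contra! hlt
        exact hone (j + 1 + m') (by omega) (by omega) ((hab _ (by omega)).trans hm1')
      have ha1 : a (j + m + 1) = true := by rwa [add_right_comm]
      have hb1 : b (j + m' + 1) = true := by rwa [add_right_comm]
      have h1 := F.abs_limit_sub_ratio_le S hs hs0 (by omega) ha1
      have h2 := F.abs_limit_sub_ratio_le S hs hs0 (by omega) hb1
      have h3 := (S 0 F.zero_mem).abs_ratio_sub_ratio_critical_le F.branch_zero_one hj1 hjm hjm'
        (fun k hk => hab k (by omega))
        (zeros hm) (zeros hm') ha1 hb1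
      have h4 := mul_le_mul_of_nonneg_left (P.θ_pow_le (show j ≤ j + m + 1 by omega)) hT.le
      have h5 := mul_le_mul_of_nonneg_left (P.θ_pow_le (show j ≤ j + m' + 1 by omega)) hT.le
      rw [abs_le] at h1 h2 h3 ⊢
      constructor <;> linarith [h1.1, h1.2, h2.1, h2.2, h3.1, h3.2]
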